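/- arXiv:math/0608491 — 4 statements merged into one kernel-verified Lean document; each statement's English description precedes it below -/
import Mathlib

section
/- There exists a constant C > 0 such that for every field k and every integer n ≥ 1, the Krull dimension of the ring R_n(k) satisfies |dim R_n(k) - (2/27)n^3| ≤ C n^{8/3}. -/
open MvPolynomial in
/-- The defining relations of the moduli space of based rank-`n` algebras:
commutativity `c_{ijl} - c_{jil}`, associativity
`Σ_m c_{ijm} c_{mkl} - Σ_m c_{jkm} c_{iml}`, and the unit relations
`Σ_i d_i c_{ijl} - δ_{jl}`.  The variable `Sum.inl (i,j,l)` is `c_{ijl}` and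
`Sum.inr i` is `d_i`. -/
def structRels (k : Type) [CommRing k] (n : ℕ) :
    Set (MvPolynomial ((Fin n × Fin n × Fin n) ⊕ Fin n) k) :=
  (Set.range fun t : Fin n × Fin n × Fin n =>
      (X (Sum.inl (t.1, t.2.1, t.2.2)) : MvPolynomial ((Fin n × Fin n × Fin n) ⊕ Fin n) k)
        - X (Sum.inl (t.2.1, t.1, t.2.2)))
  ∪ (Set.range fun t : Fin n × Fin n × Fin n × Fin n =>
      (∑ m : Fin n, X (Sum.inl (t.1, t.2.1, m)) * X (Sum.inl (m, t.2.2.1, t.2.2.2)))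
        - ∑ m : Fin n, X (Sum.inl (t.2.1, t.2.2.1, m)) * X (Sum.inl (t.1, m, t.2.2.2)))
  ∪ (Set.range fun t : Fin n × Fin n =>
      (∑ i : Fin n, X (Sum.inr i) * X (Sum.inl (i, t.1, t.2)))
        - if t.1 = t.2 then 1 else 0)

/-- `Rring k n` is the coordinate ring of the moduli space `B_{n,k}` of based
rank-`n` algebras: the polynomial ring in the `n^3 + n` variables `c_{ijl}`, `d_i`
modulo the commutativity, associativity and unit relations. -/
abbrev Rring (k : Type) [CommRing k] (n : ℕ) : Type :=
  MvPolynomial ((Fin n × Fin n × Fin n) ⊕ Fin n) k ⧸ Ideal.span (structRels k n)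


theorem exists_linIndep_perturb {K W ι : Type*} [Field K] [Infinite K] [AddCommGroup W] [Module K W]
    [Finite ι] (p q : ι → W) (hp : LinearIndependent K p) :
    ∃ c : K, c ≠ 0 ∧ LinearIndependent K (fun i => p i + c • q i) := by
  classical
  have := Fintype.ofFinite ι
  set P : (ι → K) →ₗ[K] W := Fintype.linearCombination K p with hP
  set Q : (ι → K) →ₗ[K] W := Fintype.linearCombination K q with hQ
  have hinj : LinearMap.ker P = ⊥ := by
    rw [LinearMap.ker_eq_bot]
    exact (linearIndependent_iff_injective_fintypeLinearCombination ).1 hp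
  obtain ⟨φ, hφ⟩ := P.exists_leftInverse_of_injective hinj
  let B : Module.End K (ι → K) := φ ∘ₗ Q
  have hfin := (Module.End.finite_hasEigenvalue B).union (Set.finite_singleton (0 : K))
  obtain ⟨μ, hμ⟩ := hfin.exists_notMem
  simp only [Set.mem_union, Set.mem_ofPred_eq, Set.mem_singleton_iff, not_or] at hμ
  refine ⟨-μ⁻¹, by simp [hμ.2], ?_⟩
  rw [linearIndependent_iff_injective_fintypeLinearCombination, ← LinearMap.ker_eq_bot, LinearMap.ker_eq_bot']
  intro x hx
  by_contra hx0
  apply hμ.1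
  refine Module.End.hasEigenvalue_of_hasEigenvector (x := x) ⟨?_, hx0⟩
  rw [Module.End.mem_eigenspace_iff]
  have h1 : P x + (-μ⁻¹) • Q x = 0 := by
    rw [← hx]
    simp [hP, hQ, Fintype.linearCombination_apply, Finset.smul_sum, Finset.sum_add_distrib,
      Finset.sum_neg_distrib, smul_smul, mul_comm]
  have h2 := congrArg φ h1
  have h3 : φ (P x) = x := LinearMap.congr_fun hφ x
  simp only [map_add, map_smul, map_zero, h3] at h2
  change φ (Q x) = μ • x
  have h4 : x = μ⁻¹ • φ (Q x) := by
    have := eq_neg_of_add_eq_zero_left h2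
    exact this.trans (by simp)
  conv_rhs => rw [h4]
  rw [smul_smul, mul_inv_cancel₀ hμ.2, one_smul]

theorem map_ker_le_range_of_rank_max {K V W : Type*} [Field K] [Infinite K]
    [AddCommGroup V] [Module K V] [AddCommGroup W] [Module K W] [FiniteDimensional K W]
    (f g : V →ₗ[K] W)
    (h : ∀ c : K, Module.finrank K (LinearMap.range (f + c • g)) ≤
      Module.finrank K (LinearMap.range f)) (u : V) (hu : f u = 0) :
    g u ∈ LinearMap.range f := by
  by_contra hg
  set b := Module.finBasis K (LinearMap.range f)
  choose v hv using fun i => (b i).2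
  set p : Option (Fin (Module.finrank K (LinearMap.range f))) → W :=
    fun o => o.elim (g u) (fun i => (b i : W)) with hp
  set q : Option (Fin (Module.finrank K (LinearMap.range f))) → W :=
    fun o => o.elim 0 (fun i => g (v i)) with hq
  have hb : LinearIndependent K (fun i => (b i : W)) :=
    b.linearIndependent.map' (LinearMap.range f).subtype (Submodule.ker_subtype _)
  have hpl : LinearIndependent K p := by
    rw [linearIndependent_option]
    refine ⟨hb, ?_⟩
    intro hmem
    apply hg
    have : Submodule.span K (Set.range (p ∘ some)) ≤ LinearMap.range f := by
      rw [Submodule.span_le]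
      rintro _ ⟨i, rfl⟩
      exact (b i).2
    exact this hmem
  obtain ⟨c, hc, hli⟩ := exists_linIndep_perturb p q hpl
  have hmem : ∀ o, p o + c • q o ∈ LinearMap.range (f + c • g) := by
    rintro (_ | i)
    · refine ⟨c⁻¹ • u, ?_⟩
      simp [hp, hq, hu, hc]
    · refine ⟨v i, ?_⟩
      simp [hp, hq, hv]
  have h1 : Fintype.card (Option (Fin (Module.finrank K (LinearMap.range f)))) ≤
      Module.finrank K (LinearMap.range (f + c • g)) := by
    refine LinearIndependent.fintype_card_le_finrank
      (b := fun o => (⟨p o + c • q o, hmem o⟩ : LinearMap.range (f + c • g))) ?_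
    exact LinearIndependent.of_comp (LinearMap.range (f + c • g)).subtype hli
  have := h c
  simp at h1
  omega

theorem finrank_le_of_rank_le {K V W : Type*} [Field K] [Infinite K]
    [AddCommGroup V] [Module K V] [AddCommGroup W] [Module K W] [FiniteDimensional K W]
    [FiniteDimensional K V]
    (β : V →ₗ[K] V →ₗ[K] W) (hsymm : ∀ x y, β x y = β y x)
    (hspan : ∀ M : Submodule K W, (∀ x y, β x y ∈ M) → M = ⊤) (ρ : ℕ)
    (hρ : ∀ y, Module.finrank K (LinearMap.range (β y)) ≤ ρ) :
    Module.finrank K W ≤ ρ + ρ * ρ := by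
  classical
  obtain ⟨y, hy⟩ : ∃ y, ∀ z, Module.finrank K (LinearMap.range (β z)) ≤
      Module.finrank K (LinearMap.range (β y)) := by
    have hbdd : BddAbove (Set.range fun y => Module.finrank K (LinearMap.range (β y))) :=
      ⟨ρ, by rintro _ ⟨y, rfl⟩; exact hρ y⟩
    obtain ⟨y, hy⟩ := Nat.sSup_mem (Set.range_nonempty _) hbdd
    refine ⟨y, fun z => ?_⟩
    change _ = _ at hy
    simp only at hy
    rw [hy]
    exact le_csSup hbdd ⟨z, rfl⟩
  have hker : ∀ z u, β y u = 0 → β z u ∈ LinearMap.range (β y) := fun z u hu => by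
    refine map_ker_le_range_of_rank_max (β y) (β z) (fun c => ?_) u hu
    have h0 := hy (y + c • z)
    rwa [map_add, map_smul] at h0
  obtain ⟨C, hC⟩ := Submodule.exists_isCompl (LinearMap.ker (β y))
  have hCdim : Module.finrank K C ≤ ρ := by
    have h1 := Submodule.finrank_add_eq_of_isCompl hC
    have h2 := LinearMap.finrank_range_add_finrank_ker (β y)
    have := hρ y
    omega
  set b := Module.finBasis K C
  set S : Finset W := Finset.univ.image
    (fun ij : Fin (Module.finrank K C) × Fin (Module.finrank K C) => β (b ij.1) (b ij.2)) with hS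
  have hScard : S.card ≤ ρ * ρ := by
    refine Finset.card_image_le.trans ?_
    simp only [Finset.card_univ, Fintype.card_prod, Fintype.card_fin]
    exact Nat.mul_le_mul hCdim hCdim
  have hbC : ∀ v ∈ C, v ∈ Submodule.span K (Set.range fun i => (b i : V)) := by
    intro v hv
    have := b.mem_span (⟨v, hv⟩ : C)
    have h2 := Submodule.mem_map_of_mem (f := C.subtype) this
    rw [Submodule.map_span, ← Set.range_comp] at h2
    exact h2
  have hCC : ∀ v ∈ C, ∀ w ∈ C, β v w ∈ Submodule.span K (S : Set W) := by
    intro v hv w hw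
    have h1 := Submodule.apply_mem_map₂ β (hbC v hv) (hbC w hw)
    rw [Submodule.map₂_span_span] at h1
    refine Submodule.span_mono ?_ h1
    rintro _ ⟨_, ⟨i, rfl⟩, _, ⟨j, rfl⟩, rfl⟩
    simp only [hS, Finset.coe_image, Finset.coe_univ, Set.image_univ]
    exact ⟨(i, j), rfl⟩
  have htop := hspan (LinearMap.range (β y) ⊔ Submodule.span K (S : Set W)) (by
    intro x z
    have hdec : ∀ v : V, ∃ u w, β y u = 0 ∧ w ∈ C ∧ v = u + w := by
      intro v
      have : v ∈ LinearMap.ker (β y) ⊔ C := by rw [hC.sup_eq_top]; trivial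
      obtain ⟨u, hu, w, hw, h⟩ := Submodule.mem_sup.1 this
      exact ⟨u, w, hu, hw, h.symm⟩
    obtain ⟨u, w, hu, hw, rfl⟩ := hdec x
    obtain ⟨u', w', hu', hw', rfl⟩ := hdec z
    have e : β (u + w) (u' + w') = (β (u + w) u' + β w' u) + β w w' := by
      rw [hsymm w' u]; simp; abel
    rw [e]
    exact Submodule.add_mem_sup (add_mem (hker _ _ hu') (hker _ _ hu)) (hCC _ hw _ hw'))
  have h3 := Submodule.finrank_add_le_finrank_add_finrank (LinearMap.range (β y))
    (Submodule.span K (S : Set W))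
  rw [htop, finrank_top] at h3
  have h4 := finrank_span_finset_le_card (R := K) S
  have h5 := hρ y
  have h6 : Set.finrank K (S : Set W) = Module.finrank K (Submodule.span K (S : Set W)) := rfl
  omega

theorem greedy {K V : Type*} [Field K] [Infinite K]
    [AddCommGroup V] [Module K V] [FiniteDimensional K V] (ρ : ℕ) (N : ℕ) :
    ∀ {W : Type*} [AddCommGroup W] [Module K W] [FiniteDimensional K W]
    (β : V →ₗ[K] V →ₗ[K] W) (_ : ∀ x y, β x y = β y x)
    (_ : ∀ M : Submodule K W, (∀ x y, β x y ∈ M) → M = ⊤)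
    (_ : Module.finrank K W ≤ N),
    ∃ (Y : Finset V) (E : Finset W), Y.card * (ρ + 1) ≤ N ∧ E.card ≤ ρ + ρ * ρ ∧
      ∀ M : Submodule K W, (∀ y ∈ Y, ∀ v, β y v ∈ M) → (∀ e ∈ E, e ∈ M) → M = ⊤ := by
  classical
  induction N using Nat.strong_induction_on with
  | _ N ih =>
  intro W _ _ _ β hsymm hspan hN
  by_cases hρ : ∀ y, Module.finrank K (LinearMap.range (β y)) ≤ ρ
  · refine ⟨∅, Finset.univ.image (Module.finBasis K W), by simp, ?_, ?_⟩
    · refine Finset.card_image_le.trans ?_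
      simpa using finrank_le_of_rank_le β hsymm hspan ρ hρ
    · intro M _ hM
      rw [eq_top_iff, ← (Module.finBasis K W).span_eq, Submodule.span_le]
      rintro _ ⟨i, rfl⟩
      exact hM _ (by simp)
  · push Not at hρ
    obtain ⟨y, hy⟩ := hρ
    set U := LinearMap.range (β y) with hU
    have hdim := Submodule.finrank_quotient_add_finrank U
    obtain ⟨Y, E, hY, hE, h⟩ := ih (N - (ρ + 1)) (by omega) (W := W ⧸ U) (β.compr₂ U.mkQ)
      (by intro x z; simp [hsymm x z])
      (by
        intro M hM
        have := hspan (M.comap U.mkQ) (fun x z => by simpa using hM x z)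
        rw [eq_top_iff]
        intro w _
        obtain ⟨w, rfl⟩ := U.mkQ_surjective w
        have h2 : w ∈ M.comap U.mkQ := by rw [this]; trivial
        exact h2)
      (by omega)
    choose lift hlift using U.mkQ_surjective
    refine ⟨insert y Y, E.image lift, ?_, Finset.card_image_le.trans hE, ?_⟩
    · have := Finset.card_insert_le y Y
      calc _ ≤ (Y.card + 1) * (ρ + 1) := Nat.mul_le_mul_right _ this
        _ ≤ N := by
          have : ρ + 1 ≤ N := by omega
          rw [add_mul, one_mul]; omega
    · intro M hM hME
      have hUM : U ≤ M := by
        rintro _ ⟨v, rfl⟩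
        exact hM y (by simp) v
      have h1 := h (M.map U.mkQ)
        (fun z hz v => ⟨β z v, hM z (by simp [hz]) v, by simp⟩)
        (fun e he => ⟨lift e, hME _ (Finset.mem_image_of_mem _ he), hlift e⟩)
      rw [eq_top_iff]
      intro w _
      have h2 : U.mkQ w ∈ M.map U.mkQ := by rw [h1]; trivial
      obtain ⟨w', hw', he⟩ := h2
      have h3 : w - w' ∈ U := by
        rw [← U.ker_mkQ, LinearMap.mem_ker, map_sub, he, sub_self]
      have := M.add_mem (hUM h3) hw'
      simpa using this

theorem exists_theta {K A : Type*} [Field K] [IsAlgClosed K] [CommRing A] [Algebra K A]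
    [FiniteDimensional K A] :
    ∃ θ : A, ∀ a : A, ∃ f : Polynomial K, a - Polynomial.aeval θ f ∈ nilradical A := by
  classical
  have : IsArtinianRing A := IsArtinianRing.of_finite K A
  have : Infinite K := IsAlgClosed.instInfinite
  have := Fintype.ofFinite (MaximalSpectrum A)
  have hval : ∀ (a : A) (I : MaximalSpectrum A), ∃ c : K, a - algebraMap K A c ∈ I.asIdeal := by
    intro a I
    have := I.isMaximal
    let _ := Ideal.Quotient.field I.asIdeal
    obtain ⟨c, hc⟩ := (IsAlgClosed.algebraMap_bijective_of_isIntegral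
      (k := K) (K := A ⧸ I.asIdeal)).2 (Ideal.Quotient.mk _ a)
    refine ⟨c, ?_⟩
    rw [← Ideal.Quotient.eq, ← hc]
    rfl
  choose val hval using hval
  let e : MaximalSpectrum A → K := fun I => Infinite.natEmbedding K (Fintype.equivFin _ I)
  have he : Function.Injective e := (Infinite.natEmbedding K).injective.comp
    (Fin.val_injective.comp (Fintype.equivFin _).injective)
  obtain ⟨θ', hθ'⟩ := (IsArtinianRing.quotNilradicalEquivPi A).surjective
    (fun I => Ideal.Quotient.mk _ (algebraMap K A (e I)))
  obtain ⟨θ, rfl⟩ := Ideal.Quotient.mk_surjective θ'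
  have hθ : ∀ I : MaximalSpectrum A, θ - algebraMap K A (e I) ∈ I.asIdeal := by
    intro I
    rw [← Ideal.Quotient.eq]
    exact congrFun hθ' I
  refine ⟨θ, fun a => ⟨Lagrange.interpolate Finset.univ e (val a), ?_⟩⟩
  rw [IsArtinianRing.nilradical_eq_iInf, Submodule.mem_iInf]
  intro I
  have h1 := hval a I
  have h2 : (Lagrange.interpolate Finset.univ e (val a)).eval (e I) = val a I :=
    Lagrange.eval_interpolate_at_node _ he.injOn (Finset.mem_univ I)
  rw [← Ideal.Quotient.eq] at h1 ⊢
  have h3 := hθ I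
  rw [← Ideal.Quotient.eq] at h3
  rw [h1, ← h2]
  have h4 : ∀ f : Polynomial K, Ideal.Quotient.mk I.asIdeal (Polynomial.aeval θ f) =
      Ideal.Quotient.mk I.asIdeal (algebraMap K A (f.eval (e I))) := by
    intro f
    have h5 : ∀ t : A, Ideal.Quotient.mk I.asIdeal (Polynomial.aeval t f) =
        Polynomial.aeval (Ideal.Quotient.mk I.asIdeal t) f := fun t =>
      (Polynomial.aeval_algHom_apply (Ideal.Quotient.mkₐ K I.asIdeal) t f).symm
    rw [h5, h3, ← h5, Polynomial.aeval_algebraMap_apply]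
    simp
  exact (h4 _).symm

theorem exists_generators {K A : Type*} [Field K] [IsAlgClosed K] [CommRing A] [Algebra K A]
    [FiniteDimensional K A] (ρ : ℕ) :
    ∃ (d r : ℕ) (x : Fin d → A) (w : Fin r → A) (Z : Finset A),
      d + r ≤ Module.finrank K A ∧
      Z.card ≤ 1 + Module.finrank K A / (ρ + 1) + (ρ + ρ * ρ) ∧
      (∀ a b, x a * x b ∈ Submodule.span K (Set.range w)) ∧
      ∀ M : Submodule K A, 1 ∈ M → (∀ a, x a ∈ M) → (∀ z ∈ Z, ∀ m ∈ M, z * m ∈ M) → M = ⊤ := by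
  classical
  have : IsArtinianRing A := IsArtinianRing.of_finite K A
  have : Infinite K := IsAlgClosed.instInfinite
  obtain ⟨θ, hθ⟩ := exists_theta (K := K) (A := A)
  obtain ⟨N, hN⟩ : ∃ N : Submodule K A, ∀ a, a ∈ N ↔ a ∈ nilradical A :=
    ⟨(nilradical A).restrictScalars K, fun a => Iff.rfl⟩
  set N2 : Submodule K A := N * N with hN2
  have hN2N : N2 ≤ N := by
    rw [hN2, Submodule.mul_le]
    intro m hm n _
    exact (hN _).2 ((nilradical A).mul_mem_right n ((hN _).1 hm))
  -- generators of N modulo N2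
  set N2' : Submodule K N := N2.comap N.subtype with hN2'
  obtain ⟨C, hC⟩ := Submodule.exists_isCompl N2'
  have : Module.Free K C := Module.Free.of_divisionRing K C
  set bC := Module.finBasis K C
  set bw := Module.finBasis K N2
  -- the bilinear map
  let β : N →ₗ[K] N →ₗ[K] N2 := LinearMap.mk₂ K
    (fun u v => ⟨u.1 * v.1, Submodule.mul_mem_mul u.2 v.2⟩)
    (by intro a b c; ext; simp [add_mul])
    (by intro a b c; ext; simp)
    (by intro a b c; ext; simp [mul_add])
    (by intro a b c; ext; simp)
  have hβ : ∀ u v, ((β u v : N2) : A) = u.1 * v.1 := fun u v => rfl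
  obtain ⟨Y, E, hY, hE, hYE⟩ := greedy ρ (Module.finrank K A) β
    (by intro u v; ext; simp [hβ, mul_comm])
    (by
      intro M hM
      rw [eq_top_iff]
      rintro ⟨t, ht⟩ _
      have : N2 ≤ M.map N2.subtype := by
        refine Submodule.mul_le.2 ?_
        intro m hm n hn
        exact ⟨β ⟨m, hm⟩ ⟨n, hn⟩, hM _ _, rfl⟩
      obtain ⟨t', ht', h⟩ := this ht
      have : t' = ⟨t, ht⟩ := Subtype.ext h
      rwa [← this])
    (Submodule.finrank_le _)
  refine ⟨Module.finrank K C, Module.finrank K N2, fun i => ((bC i : N) : A), fun i => (bw i : A),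
    insert θ (Y.image Subtype.val ∪ E.image Subtype.val), ?_, ?_, ?_, ?_⟩
  · have h1 := Submodule.finrank_add_eq_of_isCompl hC
    have h2 : Module.finrank K N2' = Module.finrank K N2 :=
      (Submodule.comapSubtypeEquivOfLe hN2N).finrank_eq
    have h3 := Submodule.finrank_le N
    omega
  · have h1 : Y.card ≤ Module.finrank K A / (ρ + 1) := (Nat.le_div_iff_mul_le (by omega)).2 hY
    have h2 := Finset.card_insert_le θ (Y.image Subtype.val ∪ E.image Subtype.val)
    have h3 := Finset.card_union_le (Y.image Subtype.val) (E.image Subtype.val)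
    have h4 := Finset.card_image_le (s := Y) (f := Subtype.val)
    have h5 := Finset.card_image_le (s := E) (f := Subtype.val)
    omega
  · intro a b
    have h1 : ((bC a : N) : A) * ((bC b : N) : A) ∈ N2 :=
      Submodule.mul_mem_mul (bC a : N).2 (bC b : N).2
    have h2 := Submodule.mem_map_of_mem (f := N2.subtype) (bw.mem_span ⟨_, h1⟩)
    rw [Submodule.map_span, ← Set.range_comp] at h2
    exact h2
  · intro M h1 hx hz
    have hθM : ∀ f : Polynomial K, Polynomial.aeval θ f ∈ M := by
      intro f
      induction f using Polynomial.induction_on' with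
      | add p q hp hq => rw [map_add]; exact M.add_mem hp hq
      | monomial i c =>
        rw [Polynomial.aeval_monomial, ← Algebra.smul_def]
        refine M.smul_mem _ ?_
        induction i with
        | zero => simpa using h1
        | succ i ih => rw [pow_succ']; exact hz θ (by simp) _ ih
    -- main iteration
    have key : ∀ j : ℕ, ∀ a : A, a ∈ M ⊔ (nilradical A ^ j).restrictScalars K := by
      intro j
      induction j with
      | zero => intro a; simp
      | succ j ih =>
        set T := M ⊔ (nilradical A ^ (j + 1)).restrictScalars K with hT
        have hzT : ∀ z ∈ N, (∀ m ∈ M, z * m ∈ M) → ∀ a : A, z * a ∈ T := by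
          intro z hzN hzM a
          obtain ⟨m, hm, p, hp, rfl⟩ := Submodule.mem_sup.1 (ih a)
          rw [mul_add]
          refine Submodule.add_mem_sup (hzM m hm) ?_
          change z * p ∈ nilradical A ^ (j + 1)
          rw [pow_succ']
          exact Ideal.mul_mem_mul ((hN _).1 hzN) hp
        have hN2T : N2 ≤ T := by
          have := hYE (T.comap N2.subtype)
            (fun y hy v => hzT y y.2 (hz y (by
              simp only [Finset.mem_insert, Finset.mem_union, Finset.mem_image]
              exact Or.inr (Or.inl ⟨y, hy, rfl⟩))) v)
            (fun e he => by
              have := hzT e (hN2N e.2) (hz e (by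
                simp only [Finset.mem_insert, Finset.mem_union, Finset.mem_image]
                exact Or.inr (Or.inr ⟨e, he, rfl⟩))) 1
              rw [mul_one] at this
              exact this)
          intro t ht
          have h2 : (⟨t, ht⟩ : N2) ∈ T.comap N2.subtype := by rw [this]; trivial
          exact h2
        have hNT : N ≤ T := by
          intro t ht
          have : (⟨t, ht⟩ : N) ∈ N2' ⊔ C := by rw [hC.sup_eq_top]; trivial
          obtain ⟨u, hu, c, hc, h⟩ := Submodule.mem_sup.1 this
          have h' : (u : A) + (c : A) = t := congrArg Subtype.val h
          rw [← h']
          refine T.add_mem (hN2T hu) (Submodule.mem_sup_left ?_)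
          have h2 : C ≤ M.comap N.subtype := by
            intro c hc
            have h2 := Submodule.mem_map_of_mem (f := C.subtype) (bC.mem_span ⟨c, hc⟩)
            rw [Submodule.map_span, ← Set.range_comp] at h2
            refine (Submodule.span_le.2 ?_) h2
            rintro _ ⟨i, rfl⟩
            exact hx i
          exact h2 hc
        intro a
        obtain ⟨f, hf⟩ := hθ a
        have : a = (a - Polynomial.aeval θ f) + Polynomial.aeval θ f := by ring
        rw [this]
        exact T.add_mem (hNT ((hN _).2 hf)) (Submodule.mem_sup_left (hθM f))
    obtain ⟨j, hj⟩ := IsArtinianRing.isNilpotent_nilradical (R := A)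
    rw [eq_top_iff]
    intro a _
    have := key j a
    rw [hj] at this
    simpa using this

inductive GenSet {A : Type*} [CommRing A] {d : ℕ} (x : Fin d → A) (Z : Finset A) : A → Prop
  | one : GenSet x Z 1
  | gen (a : Fin d) : GenSet x Z (x a)
  | mul (z q : A) (hz : z ∈ Z) (hq : GenSet x Z q) : GenSet x Z (z * q)

theorem struct_mem {k K A : Type*} [Field k] [Field K] [Algebra k K] [CommRing A] [Algebra K A]
    {n : ℕ} (b : Module.Basis (Fin n) K A) (F : IntermediateField k K)
    {d : ℕ} (x : Fin d → A) (Z : Finset A)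
    (hgen : ∀ M : Submodule K A, 1 ∈ M → (∀ a, x a ∈ M) → (∀ z ∈ Z, ∀ m ∈ M, z * m ∈ M) → M = ⊤)
    (h1 : ∀ i, b.repr 1 i ∈ F) (hx : ∀ a i, b.repr (x a) i ∈ F)
    (hxx : ∀ a a' i, b.repr (x a * x a') i ∈ F)
    (hz : ∀ z ∈ Z, ∀ i l, b.repr (z * b i) l ∈ F) (i j l : Fin n) :
    b.repr (b i * b j) l ∈ F := by
  classical
  let P : A → Prop := fun a => ∀ i, b.repr a i ∈ F
  have hP0 : P 0 := fun i => by simp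
  have hPadd : ∀ a a', P a → P a' → P (a + a') := fun a a' h h' i => by
    rw [map_add]; exact F.add_mem (h i) (h' i)
  have hPsmul : ∀ (c : K) a, c ∈ F → P a → P (c • a) := fun c a hc h i => by
    rw [map_smul]; exact F.mul_mem hc (h i)
  have hPsum : ∀ (c : Fin n → K) (v : Fin n → A), (∀ i, c i ∈ F) → (∀ i, P (v i)) →
      P (∑ i, c i • v i) := fun c v hc hv =>
    Finset.sum_induction _ P hPadd hP0 (fun i _ => hPsmul _ _ (hc i) (hv i))
  have hPz : ∀ z ∈ Z, ∀ a, P a → P (z * a) := by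
    intro z hzZ a ha
    rw [← b.sum_repr a, Finset.mul_sum]
    simp only [mul_smul_comm]
    exact hPsum _ _ ha (fun i l => hz z hzZ i l)
  have hGP : ∀ q, GenSet x Z q → P q := by
    intro q hq
    induction hq with
    | one => exact h1
    | gen a => exact hx a
    | mul z q hz _ ih => exact hPz z hz q ih
  have hGG : ∀ q q', GenSet x Z q → GenSet x Z q' → P (q * q') := by
    intro q q' hq hq'
    induction hq with
    | one => rw [one_mul]; exact hGP _ hq'
    | gen a =>
      induction hq' with
      | one => rw [mul_one]; exact hx a
      | gen a' => exact hxx a a'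
      | mul z q hz _ ih => rw [mul_left_comm]; exact hPz z hz _ ih
    | mul z q hz _ ih => rw [mul_assoc]; exact hPz z hz _ ih
  have hspan : Submodule.span K {a | GenSet x Z a} = ⊤ := by
    apply hgen
    · exact Submodule.subset_span GenSet.one
    · exact fun a => Submodule.subset_span (GenSet.gen a)
    · intro z hz m hm
      induction hm using Submodule.span_induction with
      | mem q hq => exact Submodule.subset_span (GenSet.mul z q hz hq)
      | zero => simp
      | add u v _ _ hu hv => rw [mul_add]; exact add_mem hu hv
      | smul c u _ hu => rw [mul_smul_comm]; exact Submodule.smul_mem _ _ hu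
  let toA : (Fin n → F) → A := fun u => ∑ i, (u i : K) • b i
  have toA_add : ∀ u v, toA (u + v) = toA u + toA v := fun u v => by
    simp [toA, add_smul, Finset.sum_add_distrib]
  have toA_smul : ∀ (c : F) u, toA (c • u) = (c : K) • toA u := fun c u => by
    simp [toA, mul_smul, Finset.smul_sum]
  have toA_zero : toA 0 = 0 := by simp [toA]
  have hlift : ∀ a, P a → ∃ u, toA u = a := fun a ha =>
    ⟨fun i => ⟨b.repr a i, ha i⟩, b.sum_repr a⟩
  have toA_single : ∀ i, toA (Pi.single i 1) = b i := fun i => by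
    simp only [toA]
    rw [Finset.sum_eq_single i]
    · simp
    · intro j _ hj; simp [hj]
    · simp
  have htop : Submodule.span F {u : Fin n → F | GenSet x Z (toA u)} = ⊤ := by
    by_contra hne
    obtain ⟨f, hf0, hf⟩ := Submodule.exists_le_ker_of_lt_top _ (lt_top_iff_ne_top.2 hne)
    let g : A →ₗ[K] K := b.constr K (fun i => ((f (Pi.single i 1) : F) : K))
    have hg : ∀ u, g (toA u) = ((f u : F) : K) := by
      intro u
      have : u = ∑ i, u i • Pi.single i (1 : F) := by
        ext j; simp [Finset.sum_apply, Pi.single_apply]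
      conv_rhs => rw [this]
      simp [toA, g, map_sum]
    have hker : Submodule.span K {a | GenSet x Z a} ≤ LinearMap.ker g := by
      rw [Submodule.span_le]
      intro a ha
      obtain ⟨u, rfl⟩ := hlift a (hGP a ha)
      have : u ∈ LinearMap.ker f := hf (Submodule.subset_span ha)
      change g _ = 0
      rw [hg, LinearMap.mem_ker.1 this]; simp
    rw [hspan] at hker
    apply hf0
    refine LinearMap.ext fun u => ?_
    have h3 : g (toA u) = 0 := hker (Submodule.mem_top (x := toA u))
    rw [hg] at h3
    simpa using h3
  have hmul : ∀ u v, P (toA u * toA v) := by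
    intro u v
    have hu : u ∈ Submodule.span F {u : Fin n → F | GenSet x Z (toA u)} := by rw [htop]; trivial
    have hv : v ∈ Submodule.span F {u : Fin n → F | GenSet x Z (toA u)} := by rw [htop]; trivial
    induction hu using Submodule.span_induction with
    | mem u hu =>
      induction hv using Submodule.span_induction with
      | mem v hv => exact hGG _ _ hu hv
      | zero => rw [toA_zero, mul_zero]; exact hP0
      | add v v' _ _ h h' => rw [toA_add, mul_add]; exact hPadd _ _ h h'
      | smul c v _ h => rw [toA_smul, mul_smul_comm]; exact hPsmul _ _ c.2 h
    | zero => rw [toA_zero, zero_mul]; exact hP0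
    | add v v' _ _ h h' => rw [toA_add, add_mul]; exact hPadd _ _ h h'
    | smul c v _ h => rw [toA_smul, smul_mul_assoc]; exact hPsmul _ _ c.2 h
  have := hmul (Pi.single i 1) (Pi.single j 1) l
  rwa [toA_single, toA_single] at this

theorem exists_params {k K A : Type*} [Field k] [Field K] [Algebra k K] [IsAlgClosed K]
    [CommRing A] [Algebra K A] {n : ℕ} (b : Module.Basis (Fin n) K A) (ρ : ℕ) :
    ∃ d r : ℕ, d + r ≤ n ∧ ∃ S : Finset K,
      S.card ≤ (d + 1).choose 2 * r + (r * n + (d * n + (n +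
        (1 + n / (ρ + 1) + (ρ + ρ * ρ)) * (n * n)))) ∧
      (∀ i, b.repr 1 i ∈ IntermediateField.adjoin k (S : Set K)) ∧
      ∀ i j l, b.repr (b i * b j) l ∈ IntermediateField.adjoin k (S : Set K) := by
  classical
  have : FiniteDimensional K A := b.finiteDimensional_of_finite
  have hn : Module.finrank K A = n := by simpa using Module.finrank_eq_card_basis b
  obtain ⟨d, r, x, w, Z, hdr, hZ, hxx, hgen⟩ := exists_generators (K := K) (A := A) ρ
  rw [hn] at hdr hZ
  have hcoef : ∀ p : Sym2 (Fin d), ∃ c : Fin r → K,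
      ∑ t, c t • w t = Sym2.lift ⟨fun a a' => x a * x a', fun a a' => mul_comm _ _⟩ p := by
    intro p
    induction p using Sym2.ind with
    | _ a a' =>
      rw [Sym2.lift_mk]
      exact (Submodule.mem_span_range_iff_exists_fun K).1 (hxx a a')
  choose c hc using hcoef
  let S4 : Finset K := Finset.univ.image (fun p : Sym2 (Fin d) × Fin r => c p.1 p.2)
  let S2 : Finset K := Finset.univ.image (fun p : Fin r × Fin n => b.repr (w p.1) p.2)
  let S1 : Finset K := Finset.univ.image (fun p : Fin d × Fin n => b.repr (x p.1) p.2)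
  let S0 : Finset K := Finset.univ.image (fun p : Fin n => b.repr 1 p)
  let S3 : Finset K := (Z ×ˢ (Finset.univ : Finset (Fin n × Fin n))).image
    (fun p => b.repr (p.1 * b p.2.1) p.2.2)
  refine ⟨d, r, hdr, S4 ∪ (S2 ∪ (S1 ∪ (S0 ∪ S3))), ?_, ?_⟩
  · refine (Finset.card_union_le _ _).trans (Nat.add_le_add ?_ ?_)
    · refine Finset.card_image_le.trans ?_
      simp [Sym2.card]
    refine (Finset.card_union_le _ _).trans (Nat.add_le_add ?_ ?_)
    · refine Finset.card_image_le.trans ?_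
      simp
    refine (Finset.card_union_le _ _).trans (Nat.add_le_add ?_ ?_)
    · refine Finset.card_image_le.trans ?_
      simp
    refine (Finset.card_union_le _ _).trans (Nat.add_le_add ?_ ?_)
    · refine Finset.card_image_le.trans ?_
      simp
    · refine Finset.card_image_le.trans ?_
      rw [Finset.card_product]
      refine Nat.mul_le_mul hZ ?_
      simp
  · set S := S4 ∪ (S2 ∪ (S1 ∪ (S0 ∪ S3))) with hS
    set F := IntermediateField.adjoin k (S : Set K) with hF
    have hmem : ∀ s ∈ S, s ∈ F := fun s hs => IntermediateField.subset_adjoin k _ hs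
    have h4 : ∀ p t, c p t ∈ F := fun p t => hmem _ (by
      refine Finset.mem_union_left _ (Finset.mem_image.2 ⟨(p, t), Finset.mem_univ _, rfl⟩))
    have h2 : ∀ p t, b.repr (w p) t ∈ F := fun p t => hmem _ (by
      refine Finset.mem_union_right _ (Finset.mem_union_left _
        (Finset.mem_image.2 ⟨(p, t), Finset.mem_univ _, rfl⟩)))
    have h1 : ∀ p t, b.repr (x p) t ∈ F := fun p t => hmem _ (by
      refine Finset.mem_union_right _ (Finset.mem_union_right _ (Finset.mem_union_left _
        (Finset.mem_image.2 ⟨(p, t), Finset.mem_univ _, rfl⟩))))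
    have h0 : ∀ p, b.repr 1 p ∈ F := fun p => hmem _ (by
      refine Finset.mem_union_right _ (Finset.mem_union_right _ (Finset.mem_union_right _
        (Finset.mem_union_left _ (Finset.mem_image.2 ⟨p, Finset.mem_univ _, rfl⟩)))))
    have h3 : ∀ z ∈ Z, ∀ i l, b.repr (z * b i) l ∈ F := fun z hz i l => hmem _ (by
      refine Finset.mem_union_right _ (Finset.mem_union_right _ (Finset.mem_union_right _
        (Finset.mem_union_right _ (Finset.mem_image.2 ⟨(z, i, l), ?_, rfl⟩))))
      simp [hz])
    refine ⟨h0, struct_mem b F x Z hgen h0 h1 ?_ h3⟩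
    intro a a' i
    have := hc s(a, a')
    rw [Sym2.lift_mk] at this
    simp only at this
    rw [← this, map_sum, Finsupp.finsetSum_apply]
    refine F.sum_mem fun t _ => ?_
    rw [map_smul]
    exact F.mul_mem (h4 _ _) (h2 _ _)

open scoped IntermediateField.algebraAdjoinAdjoin in
theorem card_le_of_algIndep {k K : Type} [Field k] [Field K] [Algebra k K] (S : Finset K)
    {s : ℕ} (x : Fin s → K) (hx : AlgebraicIndependent k x)
    (hmem : ∀ i, x i ∈ IntermediateField.adjoin k (S : Set K)) : s ≤ S.card := by
  classical
  set F := IntermediateField.adjoin k (S : Set K) with hF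
  let x' : Fin s → F := fun i => ⟨x i, hmem i⟩
  have hx' : AlgebraicIndependent k x' := AlgebraicIndependent.of_comp F.val hx
  have h1 := hx'.lift_cardinalMk_le_trdeg
  have hfr : IsFractionRing (Algebra.adjoin k (S : Set K)) F := inferInstance
  have halg : Algebra.IsAlgebraic (Algebra.adjoin k (S : Set K)) F :=
    (IsFractionRing.comap_isAlgebraic_iff (A := Algebra.adjoin k (S : Set K)) (K := F) (C := F)).2
      inferInstance
  have hfs : FaithfulSMul (Algebra.adjoin k (S : Set K)) F := by
    rw [faithfulSMul_iff_algebraMap_injective]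
    exact IsFractionRing.injective _ _
  have hst : IsScalarTower k (Algebra.adjoin k (S : Set K)) F :=
    IsScalarTower.of_algebraMap_eq (fun c => rfl)
  have h2 := trdeg_add_eq k (Algebra.adjoin k (S : Set K)) (A := F)
  have h0 : Algebra.trdeg (Algebra.adjoin k (S : Set K)) F = 0 := trdeg_eq_zero
  rw [h0, add_zero] at h2
  have h3 : Algebra.trdeg k (Algebra.adjoin k (S : Set K)) ≤
      Algebra.trdeg k (MvPolynomial (S : Set K) k) := by
    have hr : Algebra.adjoin k (S : Set K) =
        (MvPolynomial.aeval (R := k) (fun t : (S : Set K) => (t : K))).range := by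
      rw [← Algebra.adjoin_range_eq_range_aeval]; simp
    rw [hr]
    exact trdeg_le_of_surjective (MvPolynomial.aeval (R := k)
      (fun t : (S : Set K) => (t : K))).rangeRestrict (AlgHom.rangeRestrict_surjective _)
  rw [MvPolynomial.trdeg_of_isDomain, h2] at h3
  have h4 := h1.trans (Cardinal.lift_le.2 h3)
  simpa using h4

theorem exists_alg_of_bilin {K V ι : Type} [Field K] [AddCommGroup V] [Module K V]
    (b : Module.Basis ι K V) (μ : V →ₗ[K] V →ₗ[K] V) (e : V)
    (hcomm : ∀ u v, μ u v = μ v u) (hassoc : ∀ u v w, μ (μ u v) w = μ u (μ v w))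
    (hone : ∀ u, μ e u = u) :
    ∃ (A : Type) (_ : CommRing A) (_ : Algebra K A) (b' : Module.Basis ι K A),
      (∀ i j l, b'.repr (b' i * b' j) l = b.repr (μ (b i) (b j)) l) ∧
      ∀ i, b'.repr 1 i = b.repr e i := by
  let R : CommRing V :=
    { (inferInstance : AddCommGroup V) with
      mul := fun u v => μ u v
      one := e
      mul_assoc := hassoc
      one_mul := hone
      mul_one := fun u => (hcomm u e).trans (hone u)
      left_distrib := fun u v w => map_add (μ u) v w
      right_distrib := fun u v w => by
        change μ (u + v) w = μ u w + μ v w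
        rw [map_add]; rfl
      zero_mul := fun u => by change μ 0 u = 0; simp
      mul_zero := fun u => by change μ u 0 = 0; simp
      mul_comm := hcomm }
  let Al : Algebra K V := Algebra.ofModule
    (fun r x y => by change μ (r • x) y = r • μ x y; simp)
    (fun r x y => by change μ x (r • y) = r • μ x y; simp)
  exact ⟨V, R, Al, b, fun i j l => rfl, fun i => rfl⟩

theorem exists_alg {K : Type} [Field K] {n : ℕ} (c : Fin n → Fin n → Fin n → K) (e : Fin n → K)
    (hcomm : ∀ i j l, c i j l = c j i l)
    (hassoc : ∀ i j k l, ∑ m, c i j m * c m k l = ∑ m, c j k m * c i m l)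
    (hone : ∀ j l, ∑ i, e i * c i j l = if j = l then 1 else 0) :
    ∃ (A : Type) (_ : CommRing A) (_ : Algebra K A) (b : Module.Basis (Fin n) K A),
      (∀ i j l, b.repr (b i * b j) l = c i j l) ∧ ∀ i, b.repr 1 i = e i := by
  classical
  let b := Pi.basisFun K (Fin n)
  let μ : (Fin n → K) →ₗ[K] (Fin n → K) →ₗ[K] (Fin n → K) :=
    b.constr K (fun i => b.constr K (fun j => c i j))
  have hμ : ∀ i j, μ (b i) (b j) = c i j := fun i j => by
    simp only [μ]
    rw [Module.Basis.constr_basis, Module.Basis.constr_basis]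
  have hsum : ∀ v : Fin n → K, v = ∑ i, v i • b i := fun v => by
    ext j; simp [b, Pi.single_apply]
  have hcomm' : μ = μ.flip := b.ext fun i => b.ext fun j => by
    rw [LinearMap.flip_apply, hμ, hμ]; ext l; exact hcomm i j l
  have hone' : μ e = LinearMap.id := b.ext fun j => by
    rw [hsum e, map_sum, LinearMap.sum_apply]
    simp only [map_smul, LinearMap.smul_apply, hμ, LinearMap.id_apply]
    ext l
    simp only [Finset.sum_apply, Pi.smul_apply, smul_eq_mul, hone]
    simp [b, Pi.single_apply, eq_comm]
  have hassoc' : ∀ u v w, μ (μ u v) w = μ u (μ v w) := by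
    intro u v w
    have hb : ∀ i j k, μ (μ (b i) (b j)) (b k) = μ (b i) (μ (b j) (b k)) := by
      intro i j k
      rw [hμ, hμ, hsum (c i j), hsum (c j k)]
      simp only [map_sum, map_smul, LinearMap.sum_apply, LinearMap.smul_apply, hμ]
      ext l
      simpa [Finset.sum_apply] using hassoc i j k l
    rw [hsum u, hsum v, hsum w]
    simp only [map_sum, map_smul, LinearMap.sum_apply, LinearMap.smul_apply, hb, Finset.smul_sum]
  obtain ⟨A, R, Al, b', h1, h2⟩ := exists_alg_of_bilin b μ e
    (fun u v => by conv_lhs => rw [hcomm']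
                   rfl) hassoc' (fun u => by rw [hone']; rfl)
  refine ⟨A, R, Al, b', fun i j l => ?_, fun i => ?_⟩
  · rw [h1, hμ]; simp [b]
  · rw [h2]; simp [b]

theorem dim_le_of_integral {R S : Type} [CommRing R] [CommRing S] (f : R →+* S)
    (hf : f.IsIntegral) : ringKrullDim S ≤ ringKrullDim R := by
  let _ := f.toAlgebra
  have : Algebra.IsIntegral R S := ⟨hf⟩
  refine Order.krullDim_le_of_strictMono (PrimeSpectrum.comap f) ?_
  intro p q hpq
  have := p.2
  exact Ideal.IsIntegral.comap_lt_comap (R := R) (A := S) (I := p.asIdeal) (J := q.asIdeal) hpq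

theorem upper (k : Type) [Field k] (n : ℕ) [Nontrivial (Rring k n)] (ρ : ℕ) :
    ∃ d r : ℕ, d + r ≤ n ∧ ringKrullDim (Rring k n) ≤
      (((d + 1).choose 2 * r + (r * n + (d * n + (n +
        (1 + n / (ρ + 1) + (ρ + ρ * ρ)) * (n * n)))) : ℕ) : WithBot ℕ∞) := by
  classical
  obtain ⟨s, g, hg, hint⟩ := exists_integral_inj_algHom_of_fg k (Rring k n)
  have hdim : ringKrullDim (Rring k n) ≤ (s : WithBot ℕ∞) := by
    refine (dim_le_of_integral g.toRingHom hint).trans ?_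
    rw [MvPolynomial.ringKrullDim_of_isNoetherianRing, ringKrullDim_eq_zero_of_field]
    simp
  obtain ⟨p, hp, hpc⟩ : ∃ p : Ideal (Rring k n), p.IsPrime ∧ p.comap g.toRingHom = ⊥ := by
    let _ := g.toRingHom.toAlgebra
    have : Algebra.IsIntegral (MvPolynomial (Fin s) k) (Rring k n) := ⟨hint⟩
    obtain ⟨Q, _, hQ, h⟩ := Ideal.exists_ideal_over_prime_of_isIntegral
      (⊥ : Ideal (MvPolynomial (Fin s) k)) (⊥ : Ideal (Rring k n)) (by
        intro t ht
        have : g t = 0 := ht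
        have h2 : t = 0 := hg (by rw [this, map_zero])
        rw [h2]; exact zero_mem _)
    exact ⟨Q, hQ, h⟩
  let D := Rring k n ⧸ p
  let K := AlgebraicClosure (FractionRing D)
  let φ : Rring k n →ₐ[k] K :=
    ((IsScalarTower.toAlgHom k (FractionRing D) K).comp
      (IsScalarTower.toAlgHom k D (FractionRing D))).comp (Ideal.Quotient.mkₐ k p)
  have hφ : ∀ t, φ t = 0 → t ∈ p := by
    intro t ht
    have h1 : algebraMap (FractionRing D) K (algebraMap D (FractionRing D)
      (Ideal.Quotient.mk p t)) = 0 := ht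
    rw [map_eq_zero_iff _ (algebraMap (FractionRing D) K).injective,
      map_eq_zero_iff _ (IsFractionRing.injective D (FractionRing D)),
      Ideal.Quotient.eq_zero_iff_mem] at h1
    exact h1
  let x : Fin s → K := fun i => φ (g (MvPolynomial.X i))
  have hx : AlgebraicIndependent k x := by
    have h1 : MvPolynomial.aeval x = φ.comp g := by
      ext i; simp [x]
    rw [AlgebraicIndependent, h1, injective_iff_map_eq_zero]
    intro t ht
    have h2 : t ∈ p.comap g.toRingHom := hφ _ ht
    rwa [hpc] at h2
  let y : ((Fin n × Fin n × Fin n) ⊕ Fin n) → K := fun v => φ (Ideal.Quotient.mk _ (MvPolynomial.X v))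
  have hy : ∀ q : MvPolynomial ((Fin n × Fin n × Fin n) ⊕ Fin n) k,
      φ (Ideal.Quotient.mk _ q) = MvPolynomial.aeval y q := by
    intro q
    have : φ.comp (Ideal.Quotient.mkₐ k (Ideal.span (structRels k n))) = MvPolynomial.aeval y := by
      ext i; simp [y]
    exact AlgHom.congr_fun this q
  have hrel : ∀ q ∈ structRels k n, MvPolynomial.aeval y q = 0 := by
    intro q hq
    rw [← hy, Ideal.Quotient.eq_zero_iff_mem.2 (Ideal.subset_span hq), map_zero]
  obtain ⟨A, _, _, b, hb, hb1⟩ := exists_alg (fun i j l => y (Sum.inl (i, j, l)))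
    (fun i => y (Sum.inr i))
    (fun i j l => by
      have := hrel _ (Or.inl (Or.inl ⟨(i, j, l), rfl⟩))
      simpa [sub_eq_zero] using this)
    (fun i j m l => by
      have := hrel _ (Or.inl (Or.inr ⟨(i, j, m, l), rfl⟩))
      simpa [sub_eq_zero] using this)
    (fun j l => by
      have := hrel _ (Or.inr ⟨(j, l), rfl⟩)
      by_cases h : j = l
      · simpa [sub_eq_zero, h] using this
      · simpa [sub_eq_zero, h] using this)
  obtain ⟨d, r, hdr, S, hS, hS1, hSm⟩ := exists_params (k := k) b ρ
  refine ⟨d, r, hdr, hdim.trans ?_⟩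
  have hyF : ∀ v, y v ∈ IntermediateField.adjoin k (S : Set K) := by
    rintro (⟨i, j, l⟩ | i)
    · rw [← hb]; exact hSm i j l
    · rw [← hb1]; exact hS1 i
  have hsS : s ≤ S.card := by
    refine card_le_of_algIndep S x hx fun i => ?_
    obtain ⟨q, hq⟩ := Ideal.Quotient.mk_surjective (g (MvPolynomial.X i))
    simp only [x]
    rw [← hq, hy]
    have hmem : ∀ q : MvPolynomial ((Fin n × Fin n × Fin n) ⊕ Fin n) k,
        MvPolynomial.aeval y q ∈ IntermediateField.adjoin k (S : Set K) := by
      intro q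
      induction q using MvPolynomial.induction_on with
      | C c =>
        rw [MvPolynomial.aeval_C]
        exact (IntermediateField.adjoin k (S : Set K)).algebraMap_mem c
      | add u v hu hv => rw [map_add]; exact add_mem hu hv
      | mul_X u v hu =>
        rw [map_mul, MvPolynomial.aeval_X]; exact mul_mem hu (hyF v)
    exact hmem q
  exact_mod_cast hsS.trans hS

noncomputable def lowC (k : Type) [Field k] (d r : ℕ) :
    Option (Fin d ⊕ Fin r) → Option (Fin d ⊕ Fin r) → Option (Fin d ⊕ Fin r) →
      MvPolynomial (Sym2 (Fin d) × Fin r) k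
  | none, j, l => if j = l then 1 else 0
  | some i, none, l => if some i = l then 1 else 0
  | some (Sum.inl a), some (Sum.inl b), some (Sum.inr w) => MvPolynomial.X (s(a, b), w)
  | _, _, _ => 0

theorem lowC_comm (k : Type) [Field k] (d r : ℕ) (i j l : Option (Fin d ⊕ Fin r)) :
    lowC k d r i j l = lowC k d r j i l := by
  rcases i with _ | i | i <;> rcases j with _ | j | j <;> rcases l with _ | l | l <;>
    simp [lowC, Sym2.eq_swap]

theorem lowC_none_left (k : Type) [Field k] (d r : ℕ) (j l : Option (Fin d ⊕ Fin r)) :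
    lowC k d r none j l = if j = l then 1 else 0 := by
  simp [lowC]

theorem lowC_none_right (k : Type) [Field k] (d r : ℕ) (j l : Option (Fin d ⊕ Fin r)) :
    lowC k d r j none l = if j = l then 1 else 0 := by
  rw [lowC_comm, lowC_none_left]

theorem lowC_zero (k : Type) [Field k] (d r : ℕ) (i j h l) (m : Option (Fin d ⊕ Fin r)) :
    lowC k d r (some i) (some j) m * lowC k d r m (some h) l = 0 := by
  rcases i with i | i <;> rcases j with j | j <;> rcases m with _ | m | m <;>
    simp [lowC]

theorem lowC_assoc (k : Type) [Field k] (d r : ℕ) (i j h l : Option (Fin d ⊕ Fin r)) :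
    ∑ m, lowC k d r i j m * lowC k d r m h l = ∑ m, lowC k d r j h m * lowC k d r i m l := by
  rcases i with _ | i
  · simp [lowC_none_left]
  rcases j with _ | j
  · simp [lowC_none_left, lowC_none_right]
  rcases h with _ | h
  · simp [lowC_none_right]
  · rw [Finset.sum_eq_zero fun m _ => lowC_zero k d r i j h l m, Finset.sum_eq_zero]
    intro m _
    rw [lowC_comm k d r (some i) m l]
    exact lowC_zero k d r j h i l m

theorem lower (k : Type) [Field k] (n d r : ℕ) (hn : d + r + 1 = n) :
    (((d + 1).choose 2 * r : ℕ) : WithBot ℕ∞) ≤ ringKrullDim (Rring k n) := by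
  classical
  let e : Fin n ≃ Option (Fin d ⊕ Fin r) := Fintype.equivOfCardEq (by simp; omega)
  let T := MvPolynomial (Sym2 (Fin d) × Fin r) k
  let y : ((Fin n × Fin n × Fin n) ⊕ Fin n) → T :=
    Sum.elim (fun t => lowC k d r (e t.1) (e t.2.1) (e t.2.2)) (fun i => if e i = none then 1 else 0)
  let f : MvPolynomial ((Fin n × Fin n × Fin n) ⊕ Fin n) k →ₐ[k] T := MvPolynomial.aeval y
  have hsum : ∀ F : Option (Fin d ⊕ Fin r) → T, ∑ m : Fin n, F (e m) = ∑ m, F m :=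
    fun F => Equiv.sum_comp e F
  have hf : ∀ q ∈ Ideal.span (structRels k n), f q = 0 := by
    intro q hq
    have : Ideal.span (structRels k n) ≤ RingHom.ker f.toRingHom := by
      rw [Ideal.span_le]
      rintro _ ((⟨⟨i, j, l⟩, rfl⟩ | ⟨⟨i, j, h, l⟩, rfl⟩) | ⟨⟨j, l⟩, rfl⟩)
      · change f _ = 0
        simp [f, y, sub_eq_zero, lowC_comm k d r (e i)]
      · change f _ = 0
        simp only [f, y, map_sub, map_sum, map_mul, MvPolynomial.aeval_X, Sum.elim_inl]
        rw [hsum (fun m => lowC k d r (e i) (e j) m * lowC k d r m (e h) (e l)),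
          hsum (fun m => lowC k d r (e j) (e h) m * lowC k d r (e i) m (e l)), lowC_assoc, sub_self]
      · change f _ = 0
        have h1 : f (if j = l then 1 else 0) = if j = l then 1 else 0 := by
          split_ifs <;> simp
        rw [map_sub, h1]
        simp only [f, y, map_sum, map_mul, MvPolynomial.aeval_X, Sum.elim_inl, Sum.elim_inr]
        rw [hsum (fun m => (if m = none then 1 else 0) * lowC k d r m (e j) (e l))]
        simp [lowC_none_left]
    exact this hq
  let g : Rring k n →+* T := Ideal.Quotient.lift _ f.toRingHom hf
  have hg : Function.Surjective g := by
    have hfs : Function.Surjective f := by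
      rw [← AlgHom.range_eq_top, eq_top_iff, ← MvPolynomial.adjoin_range_X, Algebra.adjoin_le_iff]
      rintro _ ⟨⟨p, w⟩, rfl⟩
      induction p using Sym2.ind with
      | _ a b =>
        refine ⟨MvPolynomial.X (Sum.inl (e.symm (some (Sum.inl a)), e.symm (some (Sum.inl b)),
          e.symm (some (Sum.inr w)))), ?_⟩
        simp [f, y, lowC]
    intro t
    obtain ⟨q, hq⟩ := hfs t
    exact ⟨Ideal.Quotient.mk _ q, hq⟩
  refine le_trans ?_ (ringKrullDim_le_of_surjective g hg)
  rw [MvPolynomial.ringKrullDim_of_isNoetherianRing, ringKrullDim_eq_zero_of_field]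
  simp [Sym2.card]

theorem num_upper (n d r ρ : ℕ) (x : ℝ) (hx : 1 ≤ x) (hxn : x ^ 3 = n) (hρ : (ρ : ℝ) ≤ x)
    (hρ' : x < ρ + 1) (hdr : d + r ≤ n) :
    (((d + 1).choose 2 * r + (r * n + (d * n + (n +
        (1 + n / (ρ + 1) + (ρ + ρ * ρ)) * (n * n)))) : ℕ) : ℝ) ≤ 2 / 27 * (n : ℝ) ^ 3 + 10 * x ^ 8 := by
  have hch : (((d + 1).choose 2 : ℕ) : ℝ) = d * (d + 1) / 2 := by
    rw [Nat.cast_choose_two]; push_cast; ring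
  have hdiv : ((n / (ρ + 1) : ℕ) : ℝ) ≤ x ^ 2 := by
    refine Nat.cast_div_le.trans ?_
    rw [div_le_iff₀ (by positivity), ← hxn]
    push_cast
    nlinarith [sq_nonneg x]
  have hdr' : (d : ℝ) + r ≤ n := by exact_mod_cast hdr
  push_cast
  rw [hch]
  have hd : (0 : ℝ) ≤ d := by positivity
  have hr : (0 : ℝ) ≤ r := by positivity
  have hρ0 : (0 : ℝ) ≤ ρ := by positivity
  generalize ((n / (ρ + 1) : ℕ) : ℝ) = q at *
  generalize (d : ℝ) = d at *
  generalize (r : ℝ) = r at *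
  generalize (ρ : ℝ) = ρ at *
  generalize (n : ℝ) = n at *
  have hn : 1 ≤ n := by rw [← hxn]; exact one_le_pow₀ hx
  have h1 : d ^ 2 * r ≤ 4 / 27 * n ^ 3 := by
    have h2 : d ^ 2 * r ≤ d ^ 2 * (n - d) := by
      apply mul_le_mul_of_nonneg_left _ (sq_nonneg d); linarith
    have h3 : 4 / 27 * n ^ 3 - d ^ 2 * (n - d) = (d - 2 / 3 * n) ^ 2 * (d + n / 3) := by ring
    have h4 : 0 ≤ (d - 2 / 3 * n) ^ 2 * (d + n / 3) := by positivity
    linarith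
  have h2 : d * r ≤ n ^ 2 := by nlinarith
  have h3 : r * n + d * n ≤ n ^ 2 := by nlinarith
  have h4 : n ≤ n ^ 2 := by nlinarith
  have h5 : n ^ 2 ≤ x ^ 8 := by
    rw [← hxn, ← pow_mul]; exact pow_le_pow_right₀ hx (by norm_num)
  have h6 : 1 + q + (ρ + ρ * ρ) ≤ 4 * x ^ 2 := by nlinarith
  have h7 : (1 + q + (ρ + ρ * ρ)) * (n * n) ≤ 4 * x ^ 8 := by
    calc _ ≤ 4 * x ^ 2 * (n * n) := mul_le_mul_of_nonneg_right h6 (by positivity)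
      _ = 4 * x ^ 8 := by rw [← hxn]; ring
  nlinarith

theorem num_lower (n : ℕ) (hn : 1 ≤ n) :
    2 / 27 * (n : ℝ) ^ 3 - 10 * (n : ℝ) ^ 2 ≤
      (((n - 1 - n / 3 + 1).choose 2 * (n / 3) : ℕ) : ℝ) := by
  obtain rfl | hn2 : n = 1 ∨ 2 ≤ n := by omega
  · norm_num
  obtain ⟨r, hr⟩ : ∃ r, n / 3 = r := ⟨_, rfl⟩
  obtain ⟨d, hd⟩ : ∃ d, n - 1 - r = d := ⟨_, rfl⟩
  rw [hr, hd]
  have h1 : n ≤ 3 * r + 2 := by omega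
  have h2 : 2 * n ≤ 3 * d + 3 := by omega
  have h1' : (n : ℝ) ≤ 3 * r + 2 := by exact_mod_cast h1
  have h2' : 2 * (n : ℝ) ≤ 3 * d + 3 := by exact_mod_cast h2
  have hn' : (2 : ℝ) ≤ n := by exact_mod_cast hn2
  push_cast
  rw [Nat.cast_choose_two]
  push_cast
  have h3 : (2 * (n : ℝ) / 3) * (2 * n / 3 - 1) ≤ (d + 1) * d :=
    mul_le_mul (by linarith) (by linarith) (by linarith) (by linarith)
  have h4 : ((2 * (n : ℝ) / 3) * (2 * n / 3 - 1)) * ((n - 2) / 3) ≤ ((d + 1) * d) * r :=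
    mul_le_mul h3 (by linarith) (by linarith) (by positivity)
  nlinarith

theorem stmt3 :
    ∃ C : ℝ, 0 < C ∧
      ∀ (k : Type) [Field k] (n : ℕ), 1 ≤ n →
        ∃ m : ℕ, ringKrullDim (Rring k n) = m ∧
          |(m : ℝ) - (2 / 27 : ℝ) * (n : ℝ) ^ 3| ≤ C * (n : ℝ) ^ ((8 : ℝ) / 3) := by
  refine ⟨10, by norm_num, ?_⟩
  intro k _ n hn
  have hlow := lower k n (n - 1 - n / 3) (n / 3) (by omega)
  have hnt : Nontrivial (Rring k n) := by
    by_contra h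
    rw [not_nontrivial_iff_subsingleton] at h
    rw [ringKrullDim_eq_bot_of_subsingleton] at hlow
    exact absurd (le_bot_iff.1 hlow) (WithBot.coe_ne_bot)
  have hn1 : (1 : ℝ) ≤ n := by exact_mod_cast hn
  set x : ℝ := (n : ℝ) ^ ((1 : ℝ) / 3) with hx
  have hx1 : 1 ≤ x := Real.one_le_rpow hn1 (by norm_num)
  have hx3 : x ^ 3 = n := by
    rw [hx, ← Real.rpow_natCast, ← Real.rpow_mul (by positivity)]; norm_num
  have hx8 : (n : ℝ) ^ ((8 : ℝ) / 3) = x ^ 8 := by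
    rw [hx, ← Real.rpow_natCast, ← Real.rpow_mul (by positivity)]; norm_num
  obtain ⟨d, r, hdr, hup⟩ := upper k n ⌊x⌋₊
  have hU := num_upper n d r ⌊x⌋₊ x hx1 hx3 (Nat.floor_le (by linarith)) (Nat.lt_floor_add_one x) hdr
  have hL := num_lower n hn
  generalize ((d + 1).choose 2 * r + (r * n + (d * n + (n +
        (1 + n / (⌊x⌋₊ + 1) + (⌊x⌋₊ + ⌊x⌋₊ * ⌊x⌋₊)) * (n * n)))) : ℕ) = u at *
  generalize (n - 1 - n / 3 + 1).choose 2 * (n / 3) = l at *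
  obtain ⟨m, hm⟩ : ∃ m : ℕ, ringKrullDim (Rring k n) = m := by
    generalize ringKrullDim (Rring k n) = D at *
    induction D using WithBot.recBotCoe with
    | bot => simp at hlow
    | coe D =>
      induction D using ENat.recTopCoe with
      | top =>
        exfalso
        have : (⊤ : ℕ∞) ≤ (u : ℕ∞) := by exact_mod_cast hup
        simp at this
      | coe m => exact ⟨m, rfl⟩
  refine ⟨m, hm, ?_⟩
  rw [hm] at hup hlow
  have hup' : m ≤ u := by exact_mod_cast hup
  have hlow' : l ≤ m := by exact_mod_cast hlow
  have h1 : (m : ℝ) ≤ u := by exact_mod_cast hup'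
  have h2 : (l : ℝ) ≤ m := by exact_mod_cast hlow'
  have h5 : (n : ℝ) ^ 2 ≤ x ^ 8 := by
    rw [← hx3, ← pow_mul]; exact pow_le_pow_right₀ hx1 (by norm_num)
  rw [hx8, abs_le]
  constructor <;> linarith
end

section
/- For every field k and every integer n ≥ 1, the Krull dimension of R_n(k) is at least (2/27)n^3 + (1/9)n^2 + (5/3)n - 1 if n ≡ 0 (mod 3), at least (2/27)n^3 + (1/9)n^2 + (14/9)n - 20/27 if n ≡ 1 (mod 3), and at least (2/27)n^3 + (1/9)n^2 + (5/3)n - 37/27 if n ≡ 2 (mod 3). -/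
lemma dim_int {R S : Type} [CommRing R] [CommRing S] [IsDomain R] [IsDomain S] [Algebra R S] [Algebra.IsIntegral R S]
    (hinj : Function.Injective (algebraMap R S)) (m : ℕ)
    (h : (m : WithBot (WithTop ℕ)) ≤ ringKrullDim R) : (m : WithBot (WithTop ℕ)) ≤ ringKrullDim S := by
  have : FaithfulSMul R S := (faithfulSMul_iff_algebraMap_injective R S).mpr hinj
  obtain ⟨l, hl⟩ := Order.le_krullDim_iff.mp h
  obtain ⟨P, hP⟩ := Ideal.nonempty_primesOver (S := S) l.head.asIdeal
  have := hP.1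
  have := hP.2
  obtain ⟨L, hL, -⟩ := Ideal.exists_ltSeries_of_hasGoingUp l P
  exact Order.le_krullDim_iff.mpr ⟨L, hL.trans hl⟩

lemma dim_ge {k R L σ : Type} [Field k] [CommRing R] [Algebra k R] [Algebra.FiniteType k R]
    [Field L] [Algebra k L] (φ : R →ₐ[k] L) [Fintype σ] (x : σ → L)
    (hx : AlgebraicIndependent k x) (hal : ∀ i, IsAlgebraic φ.range (x i)) :
    ((Fintype.card σ : ℕ) : WithBot (WithTop ℕ)) ≤ ringKrullDim R := by
  have hsurj : Function.Surjective φ.rangeRestrict := φ.rangeRestrict_surjective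
  have hft : Algebra.FiniteType k φ.range := Algebra.FiniteType.of_surjective φ.rangeRestrict hsurj
  refine le_trans ?_ (ringKrullDim_le_of_surjective φ.rangeRestrict.toRingHom hsurj)
  obtain ⟨s, g, ginj, gint⟩ := exists_integral_inj_algHom_of_fg k φ.range
  let := g.toRingHom.toAlgebra
  have hint : Algebra.IsIntegral (MvPolynomial (Fin s) k) φ.range := ⟨gint⟩
  have hst : IsScalarTower k (MvPolynomial (Fin s) k) φ.range :=
    IsScalarTower.of_algebraMap_eq fun a => (g.commutes a).symm
  apply dim_int (R := MvPolynomial (Fin s) k) ginj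
  rw [MvPolynomial.ringKrullDim_of_isNoetherianRing]
  simp only [ringKrullDim_eq_zero_of_field, zero_add, Nat.card_eq_fintype_card, Fintype.card_fin]
  have : FaithfulSMul (MvPolynomial (Fin s) k) φ.range :=
    (faithfulSMul_iff_algebraMap_injective _ _).mpr ginj
  have h1 := trdeg_add_eq k (MvPolynomial (Fin s) k) (A := φ.range)
  rw [MvPolynomial.trdeg_of_isDomain, trdeg_eq_zero] at h1
  let E := Subalgebra.algebraicClosure φ.range L
  have hf : FaithfulSMul φ.range E := by
    rw [faithfulSMul_iff_algebraMap_injective]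
    intro a b h
    have h' := congrArg (fun z : E => (z : L)) h
    exact Subtype.ext h'
  have h2 := trdeg_add_eq k φ.range (A := E)
  rw [trdeg_eq_zero (R := φ.range)] at h2
  let y : σ → E := fun i => ⟨x i, hal i⟩
  have hy : AlgebraicIndependent k y :=
    AlgebraicIndependent.of_comp (E.val.restrictScalars k) hx
  have h3 := hy.cardinalMk_le_trdeg
  rw [← h2, ← h1] at h3
  simp at h3
  have h4 : Fintype.card σ ≤ s := by exact_mod_cast h3
  exact Nat.mono_cast h4
section
variable {L I : Type} [Field L] [Fintype I] [DecidableEq I]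

/-- structure constants -/
def cc (lam d : I → L) (B : I → I → I → L) (a b l : I) : L :=
  (lam a * (if b = l then 1 else 0) + lam b * (if a = l then 1 else 0)) - lam a * lam b * d l + B a b l

variable {lam d : I → L} {B : I → I → I → L}

lemma cc_comm (hs : ∀ a b l, B a b l = B b a l) (a b l : I) :
    cc lam d B a b l = cc lam d B b a l := by
  simp only [cc, hs a b l]; ring

lemma cc_lam (h1 : ∑ a, lam a * d a = 1) (hl : ∀ a b, ∑ l, lam l * B a b l = 0) (a b : I) :
    ∑ l, cc lam d B a b l * lam l = lam a * lam b := by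
  have e : ∀ l, cc lam d B a b l * lam l = (lam a * (if b = l then lam l else 0)
    + lam b * (if a = l then lam l else 0)) - lam a * lam b * (lam l * d l) + lam l * B a b l := by
    intro l; unfold cc; split_ifs <;> ring
  simp only [e, Finset.sum_add_distrib, Finset.sum_sub_distrib, ← Finset.mul_sum, h1, hl]
  simp; ring

lemma cc_unit (h1 : ∑ a, lam a * d a = 1) (hd : ∀ b l, ∑ a, d a * B a b l = 0) (b l : I) :
    ∑ a, d a * cc lam d B a b l = if b = l then 1 else 0 := by
  have e : ∀ a, d a * cc lam d B a b l = ((if b = l then 1 else 0) * (lam a * d a)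
    + lam b * (if a = l then d a else 0)) - lam b * d l * (lam a * d a) + d a * B a b l := by
    intro a; unfold cc; split_ifs <;> ring
  simp only [e, Finset.sum_add_distrib, Finset.sum_sub_distrib, ← Finset.mul_sum, h1, hd]
  simp

lemma cc_tri (h1 : ∑ a, lam a * d a = 1) (hl : ∀ a b, ∑ l, lam l * B a b l = 0)
    (hd : ∀ b l, ∑ a, d a * B a b l = 0)
    (hBB : ∀ a b c l, ∑ m, B a b m * B m c l = 0) (a b c l : I) :
    ∑ m, cc lam d B a b m * cc lam d B m c l =
      lam a * lam b * (if c = l then 1 else 0) + lam c * (cc lam d B a b l)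
      - lam a * lam b * lam c * d l + lam a * B b c l + lam b * B a c l := by
  have e : ∀ m, cc lam d B a b m * cc lam d B m c l =
      (cc lam d B a b m * lam m) * (if c = l then 1 else 0)
      + lam c * (if m = l then cc lam d B a b m else 0)
      - (cc lam d B a b m * lam m) * (lam c * d l)
      + ((lam a * (if b = m then B m c l else 0) + lam b * (if a = m then B m c l else 0))
      - lam a * lam b * (d m * B m c l) + B a b m * B m c l) := by
    intro m
    rw [show cc lam d B m c l = (lam m * (if c = l then 1 else 0) + lam c * (if m = l then 1 else 0)) - lam m * lam c * d l + B m c l from rfl]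
    rw [mul_add (cc lam d B a b m) _ (B m c l)]
    congr 1
    · split_ifs <;> ring
    · unfold cc
      split_ifs <;> ring
  simp only [e, Finset.sum_add_distrib, Finset.sum_sub_distrib, ← Finset.mul_sum, ← Finset.sum_mul,
    hd, hBB, cc_lam h1 hl]
  simp; ring

lemma cc_assoc (hs : ∀ a b l, B a b l = B b a l)
    (h1 : ∑ a, lam a * d a = 1) (hl : ∀ a b, ∑ l, lam l * B a b l = 0)
    (hd : ∀ b l, ∑ a, d a * B a b l = 0)
    (hBB : ∀ a b c l, ∑ m, B a b m * B m c l = 0) (a b c l : I) :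
    ∑ m, cc lam d B a b m * cc lam d B m c l = ∑ m, cc lam d B b c m * cc lam d B a m l := by
  simp only [cc_comm (lam := lam) (d := d) hs a]
  rw [cc_tri h1 hl hd hBB, ← Finset.sum_congr rfl (fun m _ => rfl)]
  rw [cc_tri h1 hl hd hBB]
  simp only [cc, hs c a, hs b a]
  ring
end

lemma Rring_hom {k L : Type} [Field k] [Field L] [Algebra k L] (n : ℕ)
    (c : Fin n → Fin n → Fin n → L) (d : Fin n → L)
    (hc : ∀ a b l, c a b l = c b a l)
    (ha : ∀ i j p l, ∑ m, c i j m * c m p l = ∑ m, c j p m * c i m l)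
    (hu : ∀ j l, ∑ i, d i * c i j l = if j = l then 1 else 0) :
    ∃ φ : Rring k n →ₐ[k] L, (∀ i j l, c i j l ∈ φ.range) ∧ ∀ i, d i ∈ φ.range := by
  let f : MvPolynomial ((Fin n × Fin n × Fin n) ⊕ Fin n) k →ₐ[k] L :=
    MvPolynomial.aeval (Sum.elim (fun t => c t.1 t.2.1 t.2.2) d)
  have hf : ∀ a ∈ Ideal.span (structRels k n), f a = 0 := by
    intro a h
    have : Ideal.span (structRels k n) ≤ RingHom.ker f := by
      rw [Ideal.span_le]
      rintro x ((⟨t, rfl⟩ | ⟨t, rfl⟩) | ⟨t, rfl⟩)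
      · simp [RingHom.mem_ker, f, hc t.1 t.2.1, sub_self]
      · simp [RingHom.mem_ker, f, ha, sub_self]
      · simp only [SetLike.mem_coe, RingHom.mem_ker, map_sub, map_sum, map_mul, f,
          MvPolynomial.aeval_X, Sum.elim_inl, Sum.elim_inr, hu]
        split_ifs <;> simp
    exact this h
  refine ⟨Ideal.Quotient.liftₐ _ f hf, fun i j l => ⟨Ideal.Quotient.mk _ (MvPolynomial.X (Sum.inl (i, j, l))), ?_⟩,
    fun i => ⟨Ideal.Quotient.mk _ (MvPolynomial.X (Sum.inr i)), ?_⟩⟩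
  · change f (MvPolynomial.X _) = _
    simp [f]
  · change f (MvPolynomial.X _) = _
    simp [f]

/-- elements algebraic over a subalgebra -/
def algSub {k L : Type} [Field k] [Field L] [Algebra k L] (S : Subalgebra k L) : Subfield L where
  carrier := {x | IsAlgebraic S x}
  mul_mem' := fun h1 h2 => h1.mul h2
  add_mem' := fun h1 h2 => h1.add h2
  one_mem' := isAlgebraic_one
  zero_mem' := isAlgebraic_zero
  neg_mem' := fun h => h.neg
  inv_mem' := fun _ h => h.inv

lemma dim_main {k L I σ : Type} [Field k] [Field L] [Algebra k L] [Fintype I] [DecidableEq I]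
    [Fintype σ] (n : ℕ) (e : Fin n ≃ I) (lam d : I → L) (B : I → I → I → L)
    (hs : ∀ a b l, B a b l = B b a l)
    (h1 : ∑ a, lam a * d a = 1) (hl : ∀ a b, ∑ l, lam l * B a b l = 0)
    (hd : ∀ b l, ∑ a, d a * B a b l = 0)
    (hBB : ∀ a b c l, ∑ m, B a b m * B m c l = 0)
    (x : σ → L) (hx : AlgebraicIndependent k x)
    (hE : ∀ E : Subfield L, (∀ a, lam a ∈ E) → (∀ a, d a ∈ E) → (∀ a b l, B a b l ∈ E) →
      ∀ i, x i ∈ E) :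
    ((Fintype.card σ : ℕ) : WithBot (WithTop ℕ)) ≤ ringKrullDim (Rring k n) := by
  obtain ⟨φ, hφc, hφd⟩ := Rring_hom (k := k) n (fun i j l => cc lam d B (e i) (e j) (e l)) (fun i => d (e i))
    (fun _ _ _ => cc_comm hs _ _ _)
    (fun i j p l => by
      have := cc_assoc hs h1 hl hd hBB (e i) (e j) (e p) (e l)
      rw [← e.sum_comp, ← e.sum_comp] at this
      exact this)
    (fun j l => by
      have := cc_unit h1 hd (e j) (e l)
      rw [← e.sum_comp] at this
      simpa using this)
  have hc : ∀ a b l, cc lam d B a b l ∈ φ.range := fun a b l => by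
    simpa using hφc (e.symm a) (e.symm b) (e.symm l)
  have hd' : ∀ a, d a ∈ φ.range := fun a => by simpa using hφd (e.symm a)
  have hS : ∀ y ∈ φ.range, y ∈ algSub φ.range := fun y hy =>
    isAlgebraic_algebraMap (⟨y, hy⟩ : φ.range)
  have hlam : ∀ a, lam a ∈ algSub φ.range := by
    intro a
    have : IsIntegral φ.range (lam a) := by
      refine isIntegral_of_smul_mem_submodule (M := L) (Submodule.span φ.range (Set.range lam)) ?_
        (Submodule.fg_span (Set.finite_range _)) _ ?_
      · intro h
        rw [Submodule.span_eq_bot] at h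
        rw [Finset.sum_eq_zero] at h1
        · exact zero_ne_one h1
        · intro b _; rw [h _ ⟨b, rfl⟩, zero_mul]
      · intro y hy
        induction hy using Submodule.span_induction with
        | mem y hy =>
          obtain ⟨b, rfl⟩ := hy
          rw [smul_eq_mul, ← cc_lam h1 hl]
          refine Submodule.sum_mem _ fun l _ => ?_
          exact Submodule.smul_mem _ (⟨_, hc a b l⟩ : φ.range) (Submodule.subset_span ⟨l, rfl⟩)
        | zero => simp
        | add y z _ _ h h' => rw [smul_add]; exact add_mem h h'
        | smul t y _ h => rw [smul_comm]; exact Submodule.smul_mem _ _ h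
    exact this.isAlgebraic
  refine dim_ge φ x hx (hE (algSub φ.range) hlam (fun a => hS _ (hd' a)) fun a b l => ?_)
  have hB : B a b l = cc lam d B a b l - ((lam a * (if b = l then 1 else 0)
      + lam b * (if a = l then 1 else 0)) - lam a * lam b * d l) := by unfold cc; ring
  rw [hB]
  have hi : ∀ (p : Prop) [Decidable p], (if p then (1:L) else 0) ∈ algSub φ.range := by
    intro p _; split_ifs
    exacts [one_mem _, zero_mem _]
  exact sub_mem (hS _ (hc a b l)) (sub_mem (add_mem (mul_mem (hlam a) (hi _)) (mul_mem (hlam b) (hi _)))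
    (mul_mem (mul_mem (hlam a) (hlam b)) (hS _ (hd' l))))

section model
variable {L : Type} [Field L] {d r : ℕ}

/-- the bilinear map -/
def BB {I : Type} (P : Fin d → I → L) (J : Fin r → I → L) (Q : Fin d → Fin d → Fin r → L)
    (a b l : I) : L :=
  ∑ j, (∑ i, ∑ i', P i a * P i' b * Q i i' j) * J j l

lemma BB_symm {I : Type} (P : Fin d → I → L) (J : Fin r → I → L) (Q : Fin d → Fin d → Fin r → L)
    (hQ : ∀ i i' j, Q i i' j = Q i' i j) (a b l : I) : BB P J Q a b l = BB P J Q b a l := by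
  unfold BB
  refine Finset.sum_congr rfl fun j _ => ?_
  congr 1
  rw [Finset.sum_comm]
  refine Finset.sum_congr rfl fun i _ => Finset.sum_congr rfl fun i' _ => ?_
  rw [hQ i' i]; ring

lemma BB_lam {I : Type} [Fintype I] (P : Fin d → I → L) (J : Fin r → I → L)
    (Q : Fin d → Fin d → Fin r → L) (lam : I → L)
    (h : ∀ j, ∑ l, lam l * J j l = 0) (a b : I) : ∑ l, lam l * BB P J Q a b l = 0 := by
  unfold BB
  simp only [Finset.mul_sum]
  rw [Finset.sum_comm]
  refine Finset.sum_eq_zero fun j _ => ?_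
  simp only [mul_left_comm (lam _)]
  rw [← Finset.mul_sum, h, mul_zero]

lemma BB_left {I : Type} [Fintype I] (P : Fin d → I → L) (J : Fin r → I → L)
    (Q : Fin d → Fin d → Fin r → L) (u : I → L)
    (h : ∀ i, ∑ a, u a * P i a = 0) (b l : I) : ∑ a, u a * BB P J Q a b l = 0 := by
  unfold BB
  simp only [Finset.mul_sum, Finset.sum_mul]
  rw [Finset.sum_comm]
  refine Finset.sum_eq_zero fun j _ => ?_
  rw [Finset.sum_comm]
  refine Finset.sum_eq_zero fun i _ => ?_
  rw [Finset.sum_comm]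
  refine Finset.sum_eq_zero fun i' _ => ?_
  have : ∀ a, u a * (P i a * P i' b * Q i i' j * J j l) =
    (P i' b * Q i i' j * J j l) * (u a * P i a) := fun a => by ring
  simp only [this]
  rw [← Finset.mul_sum, h, mul_zero]

lemma BB_BB {I : Type} [Fintype I] (P : Fin d → I → L) (J : Fin r → I → L)
    (Q : Fin d → Fin d → Fin r → L)
    (h : ∀ i j, ∑ a, J j a * P i a = 0) (a b c l : I) :
    ∑ m, BB P J Q a b m * BB P J Q m c l = 0 := by
  refine BB_left P J Q (BB P J Q a b) (fun i => ?_) c l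
  unfold BB
  simp only [Finset.sum_mul]
  rw [Finset.sum_comm]
  refine Finset.sum_eq_zero fun j _ => ?_
  rw [Finset.sum_comm]
  refine Finset.sum_eq_zero fun i1 _ => ?_
  rw [Finset.sum_comm]
  refine Finset.sum_eq_zero fun i2 _ => ?_
  simp only [mul_assoc]
  simp only [← Finset.mul_sum, h, mul_zero]

/-- kernel vectors -/
def JJ (T : Fin d → Fin r → L) (s : Fin r → L) (j : Fin r) : Option (Fin d ⊕ Fin r) → L
  | none => s j
  | some (Sum.inl i) => T i j
  | some (Sum.inr j') => if j = j' then 1 else 0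

/-- projection functionals -/
def PP (T : Fin d → Fin r → L) (s : Fin r → L) (ρ : Fin d → L) (i : Fin d) :
    Option (Fin d ⊕ Fin r) → L
  | none => ρ i
  | some (Sum.inl i') => if i = i' then 1 else 0
  | some (Sum.inr j) => -(T i j + s j * ρ i)

lemma JJ_PP (T : Fin d → Fin r → L) (s : Fin r → L) (ρ : Fin d → L) (i : Fin d) (j : Fin r) :
    ∑ a, JJ T s j a * PP T s ρ i a = 0 := by
  simp only [Fintype.sum_option, Fintype.sum_sum_type, JJ, PP]
  simp

/-- the unit vector -/
def UU (lam : Option (Fin d ⊕ Fin r) → L) (v : Fin d ⊕ Fin r → L) : Option (Fin d ⊕ Fin r) → L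
  | none => (1 - ∑ a, lam (some a) * v a) / lam none
  | some a => v a

lemma UU_lam (lam : Option (Fin d ⊕ Fin r) → L) (v : Fin d ⊕ Fin r → L) (h0 : lam none ≠ 0) :
    ∑ a, lam a * UU lam v a = 1 := by
  simp only [Fintype.sum_option, UU]
  field_simp
  ring

lemma JJ_lam (lam : Option (Fin d ⊕ Fin r) → L) (T : Fin d → Fin r → L) (s : Fin r → L)
    (hs : ∀ j, lam none * s j = -(lam (some (Sum.inr j)) + ∑ i, T i j * lam (some (Sum.inl i))))
    (j : Fin r) : ∑ l, lam l * JJ T s j l = 0 := by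
  simp only [Fintype.sum_option, Fintype.sum_sum_type, JJ, hs]
  simp [mul_comm]
  ring

lemma UU_PP (lam : Option (Fin d ⊕ Fin r) → L) (v : Fin d ⊕ Fin r → L) (h0 : lam none ≠ 0)
    (T : Fin d → Fin r → L) (s : Fin r → L) (ρ : Fin d → L) (D : L)
    (hs : ∀ j, lam none * s j = -(lam (some (Sum.inr j)) + ∑ i, T i j * lam (some (Sum.inl i))))
    (hD : D = 1 - ∑ i, lam (some (Sum.inl i)) * v (Sum.inl i)
      + ∑ j, (∑ i, T i j * lam (some (Sum.inl i))) * v (Sum.inr j))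
    (hρ : ∀ i, D * ρ i = lam none * (- v (Sum.inl i) + ∑ j, T i j * v (Sum.inr j)))
    (i : Fin d) : ∑ a, UU lam v a * PP T s ρ i a = 0 := by
  refine (mul_eq_zero.mp (?_ : lam none * _ = 0)).resolve_left h0
  simp only [Fintype.sum_option, Fintype.sum_sum_type, UU, PP]
  simp only [mul_ite, mul_one, mul_zero, Finset.sum_ite_eq, Finset.mem_univ, if_true]
  have e1 : ∑ x, v (Sum.inr x) * -(T i x + s x * ρ i) =
     - ∑ j, T i j * v (Sum.inr j) - (∑ j, s j * v (Sum.inr j)) * ρ i := by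
    rw [Finset.sum_mul, ← Finset.sum_neg_distrib, ← Finset.sum_sub_distrib]
    exact Finset.sum_congr rfl fun x _ => by ring
  have e2 : lam none * ∑ j, s j * v (Sum.inr j) = - ∑ j, lam (some (Sum.inr j)) * v (Sum.inr j)
     - ∑ j, (∑ i, T i j * lam (some (Sum.inl i))) * v (Sum.inr j) := by
    rw [Finset.mul_sum, ← Finset.sum_neg_distrib, ← Finset.sum_sub_distrib]
    exact Finset.sum_congr rfl fun x _ => by rw [← mul_assoc, hs]; ring
  rw [e1]
  have h3 := hρ i
  rw [mul_add, ← mul_assoc, mul_div_cancel₀ _ h0]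
  rw [hD] at h3
  linear_combination h3 - ρ i * e2

lemma BB_val1 (T : Fin d → Fin r → L) (s : Fin r → L) (ρ : Fin d → L)
    (Q : Fin d → Fin d → Fin r → L) (i i' : Fin d) (j : Fin r) :
    BB (PP T s ρ) (JJ T s) Q (some (Sum.inl i)) (some (Sum.inl i')) (some (Sum.inr j)) = Q i i' j := by
  simp [BB, PP, JJ, ite_mul]

lemma BB_val2 (T : Fin d → Fin r → L) (s : Fin r → L) (ρ : Fin d → L)
    (Q : Fin d → Fin d → Fin r → L) (i i' i'' : Fin d) :
    BB (PP T s ρ) (JJ T s) Q (some (Sum.inl i)) (some (Sum.inl i')) (some (Sum.inl i'')) =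
      ∑ j, Q i i' j * T i'' j := by
  simp [BB, PP, JJ, ite_mul]

lemma solve_mem (E : Subfield L) (M : Matrix (Fin r) (Fin r) L) (t : Fin r → L)
    (hM : ∀ i j, M i j ∈ E) (hdet : M.det ≠ 0) (ht : ∀ i, ∑ j, M i j * t j ∈ E) (j : Fin r) :
    t j ∈ E := by
  let M' : Matrix (Fin r) (Fin r) E := fun i j => ⟨M i j, hM i j⟩
  let y : Fin r → E := fun i => ⟨_, ht i⟩
  have hmap : E.subtype.mapMatrix M' = M := by ext; rfl
  have hd' : M'.det ≠ 0 := by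
    intro h
    apply hdet
    rw [← hmap, ← RingHom.map_det, h, map_zero]
  let t' := M'⁻¹.mulVec y
  have h1 : M'.mulVec t' = y := by
    simp only [t', Matrix.mulVec_mulVec]
    rw [Matrix.mul_nonsing_inv _ (Ne.isUnit hd'), Matrix.one_mulVec]
  have h2 : M.mulVec (fun j => t j - (t' j : L)) = 0 := by
    ext i
    have := congrArg (fun z : E => (z : L)) (congrFun h1 i)
    simp only [Matrix.mulVec, dotProduct, AddSubmonoidClass.coe_finsetSum, MulMemClass.coe_mul, y, M'] at this
    simp [Matrix.mulVec, dotProduct, mul_sub, this]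
  have h3 := congrFun (Matrix.eq_zero_of_mulVec_eq_zero hdet h2) j
  simp only [Pi.zero_apply, sub_eq_zero] at h3
  rw [h3]
  exact (t' j).2
end model

/-- parameters -/
abbrev Par (d r : ℕ) : Type :=
  Option (Fin d ⊕ Fin r) ⊕ (Fin d ⊕ Fin r) ⊕ (Fin d × Fin r) ⊕ (Sym2 (Fin d) × Fin r)

lemma Par_card (d r : ℕ) : Fintype.card (Par d r) =
    (d + r + 1) + ((d + r) + (d * r + (d + 1).choose 2 * r)) := by
  simp [Par, Sym2.card]

lemma dim_par (k : Type) [Field k] (d r : ℕ) (hr : r ≤ d) :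
    ((Fintype.card (Par d r) : ℕ) : WithBot (WithTop ℕ)) ≤ ringKrullDim (Rring k (d + r + 1)) := by
  classical
  let A := MvPolynomial (Par d r) k
  let L := FractionRing A
  let x : Par d r → L := fun i => algebraMap A L (MvPolynomial.X i)
  have hinj : Function.Injective (algebraMap A L) := IsFractionRing.injective A L
  have hx : AlgebraicIndependent k x :=
    (MvPolynomial.algebraicIndependent_X (Par d r) k).map' (f := IsScalarTower.toAlgHom k A L) hinj
  let lam : Option (Fin d ⊕ Fin r) → L := fun a => x (Sum.inl a)
  let v : Fin d ⊕ Fin r → L := fun a => x (Sum.inr (Sum.inl a))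
  let T : Fin d → Fin r → L := fun i j => x (Sum.inr (Sum.inr (Sum.inl (i, j))))
  let Q : Fin d → Fin d → Fin r → L := fun i i' j => x (Sum.inr (Sum.inr (Sum.inr (s(i, i'), j))))
  let D : L := 1 - ∑ i, lam (some (Sum.inl i)) * v (Sum.inl i)
      + ∑ j, (∑ i, T i j * lam (some (Sum.inl i))) * v (Sum.inr j)
  have h0 : lam none ≠ 0 := by
    simp only [lam, x]
    rw [Ne, map_eq_zero_iff _ hinj]
    exact MvPolynomial.X_ne_zero _
  have hD : D ≠ 0 := by
    let Dp : A := 1 - ∑ i : Fin d, MvPolynomial.X (Sum.inl (some (Sum.inl i))) * MvPolynomial.X (Sum.inr (Sum.inl (Sum.inl i)))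
      + ∑ j : Fin r, (∑ i : Fin d, MvPolynomial.X (Sum.inr (Sum.inr (Sum.inl (i, j)))) * MvPolynomial.X (Sum.inl (some (Sum.inl i)))) * MvPolynomial.X (Sum.inr (Sum.inl (Sum.inr j)))
    have e : D = algebraMap A L Dp := by
      simp only [D, Dp, lam, v, T, x, map_add, map_sub, map_one, map_sum, map_mul]
    rw [e, Ne, map_eq_zero_iff _ hinj]
    intro h
    have := congrArg MvPolynomial.constantCoeff h
    simp [Dp] at this
  let M : Matrix (Fin r) (Fin r) L := fun i j => Q (Fin.castLE hr i) (Fin.castLE hr i) j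
  have hdet : M.det ≠ 0 := by
    let g : MvPolynomial (Fin r × Fin r) k →ₐ[k] A := MvPolynomial.rename
      (fun p => Sum.inr (Sum.inr (Sum.inr (s(Fin.castLE hr p.1, Fin.castLE hr p.1), p.2))))
    have hg : Function.Injective g := by
      apply MvPolynomial.rename_injective
      rintro ⟨a, b⟩ ⟨a', b'⟩ h
      simpa using h
    have e : M = ((algebraMap A L).comp g.toRingHom).mapMatrix (Matrix.mvPolynomialX (Fin r) (Fin r) k) := by
      ext i j
      simp only [M, Q, x, RingHom.mapMatrix_apply, Matrix.map_apply, Matrix.mvPolynomialX_apply]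
      change _ = algebraMap A L (g (MvPolynomial.X (i, j)))
      congr 1
      exact (MvPolynomial.rename_X (R := k) (fun p : Fin r × Fin r => (Sum.inr (Sum.inr (Sum.inr (s(Fin.castLE hr p.1, Fin.castLE hr p.1), p.2))) : Par d r)) (i, j)).symm
    have hc : Function.Injective ((algebraMap A L).comp g.toRingHom) := hinj.comp hg
    rw [e, ← RingHom.map_det, Ne, map_eq_zero_iff _ hc]
    exact Matrix.det_mvPolynomialX_ne_zero _ _
  let s : Fin r → L := fun j =>
    -(lam (some (Sum.inr j)) + ∑ i, T i j * lam (some (Sum.inl i))) / lam none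
  have hs : ∀ j, lam none * s j = -(lam (some (Sum.inr j)) + ∑ i, T i j * lam (some (Sum.inl i))) :=
    fun j => mul_div_cancel₀ _ h0
  let ρ : Fin d → L := fun i => lam none * (- v (Sum.inl i) + ∑ j, T i j * v (Sum.inr j)) / D
  have hρ : ∀ i, D * ρ i = lam none * (- v (Sum.inl i) + ∑ j, T i j * v (Sum.inr j)) :=
    fun j => mul_div_cancel₀ _ hD
  have e : Fin (d + r + 1) ≃ Option (Fin d ⊕ Fin r) :=
    Fintype.equivOfCardEq (by simp)
  refine dim_main (d + r + 1) e lam (UU lam v) (BB (PP T s ρ) (JJ T s) Q) ?_ (UU_lam lam v h0)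
    (BB_lam _ _ _ _ (JJ_lam lam T s hs)) (BB_left _ _ _ _ (UU_PP lam v h0 T s ρ D hs rfl hρ))
    (BB_BB _ _ _ (JJ_PP T s ρ)) x hx ?_
  · apply BB_symm
    intro i i' j
    simp only [Q, Sym2.eq_swap]
  · intro E hl hu hB
    have hQ : ∀ i i' j, Q i i' j ∈ E := fun i i' j => by
      rw [← BB_val1 T s ρ Q]; exact hB _ _ _
    rintro (a | a | ⟨i, j⟩ | ⟨p, j⟩)
    · exact hl a
    · exact hu (some a)
    · exact solve_mem E M (T i) (fun _ _ => hQ _ _ _) hdet (fun i' => by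
        simp only [M]
        rw [← BB_val2 T s ρ Q]; exact hB _ _ _) j
    · induction p with
      | _ i i' => exact hQ i i' j

/-- For every field `k` and `n ≥ 1`, the Krull dimension of `R_n(k)` is at least
`(2/27)n³ + (1/9)n² + (5/3)n - 1` if `n ≡ 0 (mod 3)`, at least
`(2/27)n³ + (1/9)n² + (14/9)n - 20/27` if `n ≡ 1 (mod 3)`, and at least
`(2/27)n³ + (1/9)n² + (5/3)n - 37/27` if `n ≡ 2 (mod 3)`. -/
theorem stmt4 (k : Type) [Field k] (n : ℕ) (hn : 1 ≤ n) :
    ∃ m : ℕ,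
      (if n % 3 = 0 then
          (2 / 27 : ℚ) * (n : ℚ) ^ 3 + (1 / 9) * (n : ℚ) ^ 2 + (5 / 3) * (n : ℚ) - 1
        else if n % 3 = 1 then
          (2 / 27 : ℚ) * (n : ℚ) ^ 3 + (1 / 9) * (n : ℚ) ^ 2 + (14 / 9) * (n : ℚ) - 20 / 27
        else
          (2 / 27 : ℚ) * (n : ℚ) ^ 3 + (1 / 9) * (n : ℚ) ^ 2 + (5 / 3) * (n : ℚ) - 37 / 27)
        ≤ (m : ℚ) ∧
      (m : WithBot (WithTop ℕ)) ≤ ringKrullDim (Rring k n) := by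
  have key : ∀ d r : ℕ, n = d + r + 1 → r ≤ d → ∃ m : ℕ,
      (m : ℚ) = 2 * n - 1 + r * d * (d + 3) / 2 ∧
      (m : WithBot (WithTop ℕ)) ≤ ringKrullDim (Rring k n) := by
    rintro d r rfl hr
    refine ⟨_, ?_, dim_par k d r hr⟩
    rw [Par_card]
    push_cast [Nat.cast_choose_two]
    ring
  have h3 : n % 3 = 0 ∨ n % 3 = 1 ∨ n % 3 = 2 := by omega
  rcases h3 with h | h | h
  · obtain ⟨q, rfl⟩ : ∃ q, n = 3 * (q + 1) := ⟨n / 3 - 1, by omega⟩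
    obtain ⟨m, hm, hm'⟩ := key (2 * q + 1) (q + 1) (by ring) (by omega)
    refine ⟨m, ?_, hm'⟩
    rw [if_pos h, hm]
    push_cast
    apply le_of_eq
    ring
  · obtain ⟨q, rfl⟩ : ∃ q, n = 3 * q + 1 := ⟨n / 3, by omega⟩
    obtain ⟨m, hm, hm'⟩ := key (2 * q) q (by ring) (by omega)
    refine ⟨m, ?_, hm'⟩
    rw [if_neg (by omega), if_pos h, hm]
    push_cast
    apply le_of_eq
    ring
  · obtain ⟨q, rfl⟩ : ∃ q, n = 3 * q + 2 := ⟨n / 3, by omega⟩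
    have hk : ∃ m : ℕ, (m : ℚ) = 2 * q ^ 3 + 5 * q ^ 2 + 9 * q + 3 ∧
        (m : WithBot (WithTop ℕ)) ≤ ringKrullDim (Rring k (3 * q + 2)) := by
      rcases Nat.eq_zero_or_pos q with rfl | hq
      · obtain ⟨m, hm, hm'⟩ := key 1 0 (by ring) (by omega)
        refine ⟨m, ?_, hm'⟩
        rw [hm]; push_cast; ring
      · obtain ⟨m, hm, hm'⟩ := key (2 * q) (q + 1) (by ring) (by omega)
        refine ⟨m, ?_, hm'⟩
        rw [hm]; push_cast; ring
    obtain ⟨m, hm, hm'⟩ := hk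
    refine ⟨m, ?_, hm'⟩
    rw [if_neg (by omega), if_neg (by omega), hm]
    push_cast
    apply le_of_eq
    ring
end

section
/- Let k be a field and let n, d, r be nonnegative integers with r ≤ d(d+1)/2 and n = 1 + d + r. Then the Krull dimension of R_n(k) is at least r(d(d+1)/2 - r) + n^2 - (d^2 + dr). -/
namespace BA
open Finset

section alg
variable {S I : Type} [CommRing S] [Fintype I] [DecidableEq I]

def cc (lam u : I → S) (B : I → I → I → S) (i j l : I) : S :=
  lam i * (if j = l then 1 else 0) + lam j * (if i = l then 1 else 0) - lam i * lam j * u l + B i j l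

structure Good (lam u : I → S) (B : I → I → I → S) : Prop where
  lu : ∑ m, lam m * u m = 1
  symm : ∀ i j l, B i j l = B j i l
  Bl : ∀ i j, ∑ m, B i j m * lam m = 0
  BB : ∀ i j k l, ∑ m, B i j m * B m k l = 0
  uB : ∀ k l, ∑ m, u m * B m k l = 0

lemma Good.assoc_aux {lam u : I → S} {B : I → I → I → S} (h : Good lam u B) (i j k l : I) :
    ∑ m, cc lam u B i j m * cc lam u B m k l =
      lam i * lam j * (if k = l then 1 else 0) + lam i * lam k * (if j = l then 1 else 0)
      + lam j * lam k * (if i = l then 1 else 0) - 2 * (lam i * lam j * lam k * u l)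
      + lam i * B j k l + lam j * B i k l + lam k * B i j l := by
  have h1 : ∑ m, cc lam u B i j m * lam m = lam i * lam j := by
    have : ∀ m, cc lam u B i j m * lam m = lam i * ((if j = m then 1 else 0) * lam m)
      + lam j * ((if i = m then 1 else 0) * lam m) - lam i * lam j * (lam m * u m)
      + B i j m * lam m := by intro m; unfold cc; ring
    simp only [this, sum_add_distrib, sum_sub_distrib, ← mul_sum, h.lu, h.Bl]
    simp; ring
  have h2 : ∑ m, cc lam u B i j m * B m k l = lam i * B j k l + lam j * B i k l := by
    have : ∀ m, cc lam u B i j m * B m k l = lam i * ((if j = m then 1 else 0) * B m k l)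
      + lam j * ((if i = m then 1 else 0) * B m k l) - lam i * lam j * (u m * B m k l)
      + B i j m * B m k l := by intro m; unfold cc; ring
    simp only [this, sum_add_distrib, sum_sub_distrib, ← mul_sum, h.uB, h.BB]
    simp
  have h3 : ∑ m, cc lam u B i j m * (if m = l then 1 else 0) = cc lam u B i j l := by simp
  have : ∀ m, cc lam u B i j m * cc lam u B m k l =
      (if k = l then 1 else 0) * (cc lam u B i j m * lam m)
      + lam k * (cc lam u B i j m * (if m = l then 1 else 0))
      - lam k * u l * (cc lam u B i j m * lam m) + cc lam u B i j m * B m k l := by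
    intro m; conv_lhs => rw [cc.eq_def _ _ _ m k l]
    ring
  simp only [this, sum_add_distrib, sum_sub_distrib, ← mul_sum, h1, h2, h3]
  unfold cc; ring

lemma Good.comm {lam u : I → S} {B : I → I → I → S} (h : Good lam u B) (i j l : I) :
    cc lam u B i j l = cc lam u B j i l := by
  unfold cc; rw [h.symm i j]; ring

lemma Good.assoc {lam u : I → S} {B : I → I → I → S} (h : Good lam u B) (i j k l : I) :
    ∑ m, cc lam u B i j m * cc lam u B m k l = ∑ m, cc lam u B j k m * cc lam u B i m l := by
  simp only [fun m => h.comm i m l]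
  rw [h.assoc_aux, h.assoc_aux, h.symm k i, h.symm j i]; ring

lemma Good.unit {lam u : I → S} {B : I → I → I → S} (h : Good lam u B) (j l : I) :
    ∑ i, u i * cc lam u B i j l = if j = l then 1 else 0 := by
  have : ∀ m, u m * cc lam u B m j l = (if j = l then 1 else 0) * (lam m * u m)
      + lam j * (u m * (if m = l then 1 else 0)) - lam j * u l * (lam m * u m)
      + u m * B m j l := by intro m; unfold cc; ring
  simp only [this, sum_add_distrib, sum_sub_distrib, ← mul_sum, h.lu, h.uB]
  simp

lemma det_of_nilp [IsDomain S] (x : S) (N : Matrix I I S) (hN : IsNilpotent N) :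
    (Matrix.scalar I x + N).det = x ^ Fintype.card I := by
  have h := Matrix.isNilpotent_charpoly_sub_pow_of_isNilpotent (hN.neg)
  have h2 := sub_eq_zero.1 h.eq_zero
  have := congrArg (Polynomial.eval x) h2
  rw [Matrix.eval_charpoly] at this
  simpa using this

lemma Good.det [IsDomain S] {lam u : I → S} {B : I → I → I → S} (h : Good lam u B) (i : I) :
    (Matrix.of fun m l => cc lam u B i m l).det = lam i ^ Fintype.card I := by
  let N : Matrix I I S := Matrix.of fun m l =>
    lam m * ((if i = l then 1 else 0) - lam i * u l) + B i m l
  have e : (Matrix.of fun m l => cc lam u B i m l) = Matrix.scalar I (lam i) + N := by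
    ext m l
    simp [N, cc, Matrix.diagonal_apply]
    split_ifs <;> ring
  have key : ∀ x : I → S, ∀ l, (∑ m, x m * N m l) = (∑ m, x m * lam m) *
      ((if i = l then 1 else 0) - lam i * u l) + ∑ m, x m * B m i l := by
    intro x l
    rw [sum_mul, ← sum_add_distrib]
    refine sum_congr rfl fun m _ => ?_
    simp only [N, Matrix.of_apply, h.symm i m]; ring
  have n2 : ∀ m l, (N * N) m l = lam m * B i i l := by
    intro m l
    rw [Matrix.mul_apply, key]
    have a1 : ∑ x, N m x * lam x = 0 := by
      have : ∀ x, N m x * lam x = lam m * ((if i = x then 1 else 0) * lam x)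
          - lam m * lam i * (lam x * u x) + B i m x * lam x := by
        intro x; simp only [N, Matrix.of_apply]; ring
      simp only [this, sum_add_distrib, sum_sub_distrib, ← mul_sum, h.lu, h.Bl]
      simp
    have a2 : ∑ x, N m x * B x i l = lam m * B i i l := by
      have : ∀ x, N m x * B x i l = lam m * ((if i = x then 1 else 0) * B x i l)
          - lam m * lam i * (u x * B x i l) + B i m x * B x i l := by
        intro x; simp only [N, Matrix.of_apply]; ring
      simp only [this, sum_add_distrib, sum_sub_distrib, ← mul_sum, h.uB, h.BB]
      simp
    rw [a1, a2]; ring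
  have n3 : N * N * N = 0 := by
    ext m l
    rw [Matrix.mul_apply, key]
    simp only [n2, mul_assoc, ← mul_sum, h.Bl, h.BB]; simp
  rw [e, det_of_nilp]
  exact ⟨3, by rw [pow_succ, pow_two, n3]⟩
end alg

section chain
variable {R : Type} [CommRing R]

def pt {S : Type} [CommRing S] [IsDomain S] (φ : R →+* S) : PrimeSpectrum R :=
  ⟨RingHom.ker φ, RingHom.ker_isPrime φ⟩

lemma step {S S' : Type} [CommRing S] [IsDomain S] [CommRing S'] [IsDomain S']
    (φ : R →+* S) (ψ : R →+* S') (τ : S →+* S') (h : ψ = τ.comp φ) (f : R) (h1 : φ f ≠ 0)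
    (h2 : ψ f = 0) : Order.coheight (pt ψ) + 1 ≤ Order.coheight (pt φ) := by
  apply Order.coheight_add_one_le
  change RingHom.ker φ < RingHom.ker ψ
  refine lt_of_le_of_ne ?_ ?_
  · intro x hx
    rw [RingHom.mem_ker] at hx ⊢
    simp [h, hx]
  · intro e
    exact h1 (by rw [← RingHom.mem_ker, e]; exact h2)

noncomputable def kill {σ : Type} (L : Type) [CommRing L] [DecidableEq σ] (K : Finset σ) :
    MvPolynomial σ L →+* MvPolynomial σ L :=
  (MvPolynomial.aeval (R := L) (fun i => if i ∈ K then 0 else MvPolynomial.X i)).toRingHom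

lemma kill_X {σ : Type} (L : Type) [CommRing L] [DecidableEq σ] (K : Finset σ) (i : σ) :
    kill L K (MvPolynomial.X i) = if i ∈ K then 0 else MvPolynomial.X i := by
  simp [kill]

lemma kill_C {σ : Type} (L : Type) [CommRing L] [DecidableEq σ] (K : Finset σ) (x : L) :
    kill L K (MvPolynomial.C x) = MvPolynomial.C x := by
  simp [kill]

lemma chain_aux {σ L : Type} [CommRing L] [IsDomain L] [Fintype σ] [DecidableEq σ]
    (Φ : R →+* MvPolynomial σ L) (rk : σ → ℕ)
    (H : ∀ i, ∃ f : R, ∃ m : ℕ, m ≠ 0 ∧ ∀ K : Finset σ, (∀ j, rk j < rk i → j ∈ K) →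
      kill L K (Φ f) = kill L K (MvPolynomial.X i) ^ m) (N : ℕ) :
    ∀ K : Finset σ, (Kᶜ).card = N →
      Order.coheight (pt ((kill L univ).comp Φ)) + N ≤ Order.coheight (pt ((kill L K).comp Φ)) := by
  induction N with
  | zero =>
    intro K hK
    have : K = univ := by simpa using hK
    subst this; simp
  | succ N ih =>
    intro K hK
    obtain ⟨i, hi, hmin⟩ := (Kᶜ).exists_min_image rk (card_pos.1 (by omega))
    rw [mem_compl] at hi
    obtain ⟨f, m, hm, hf⟩ := H i
    have hlow : ∀ j, rk j < rk i → j ∈ K := by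
      intro j hj; by_contra hc
      exact absurd (hmin j (mem_compl.2 hc)) (by omega)
    have hc : ((insert i K)ᶜ).card = N := by
      rw [card_compl] at hK ⊢
      rw [card_insert_of_notMem hi]; omega
    have := ih _ hc
    have st := step ((kill L K).comp Φ) ((kill L (insert i K)).comp Φ) (kill L (insert i K)) (by
        rw [← RingHom.comp_assoc]; congr 1
        apply MvPolynomial.ringHom_ext
        · intro x; simp [kill_C]
        · intro j
          simp only [RingHom.comp_apply, kill_X]
          by_cases hj : j ∈ K <;> simp [hj, kill_X]) f
      (by simp [hf K hlow, kill_X, hi, hm])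
      (by simp [hf (insert i K) (fun j hj => mem_insert_of_mem (hlow j hj)), kill_X, hm])
    push_cast
    rw [← add_assoc]
    exact le_trans (add_le_add_left this 1) st

lemma chain {σ L L' : Type} [CommRing L] [IsDomain L] [CommRing L'] [IsDomain L']
    [Fintype σ] [DecidableEq σ]
    (Φ : R →+* MvPolynomial σ L) (rk : σ → ℕ)
    (H : ∀ i, ∃ f : R, ∃ m : ℕ, m ≠ 0 ∧ ∀ K : Finset σ, (∀ j, rk j < rk i → j ∈ K) →
      kill L K (Φ f) = kill L K (MvPolynomial.X i) ^ m)
    (τ : L →+* L') (f : R) (x : L) (hx : x ≠ 0) (hτ : τ x = 0)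
    (hf : kill L univ (Φ f) = MvPolynomial.C x) :
    ((Fintype.card σ + 1 : ℕ) : WithBot (WithTop ℕ)) ≤ ringKrullDim R := by
  have h1 := chain_aux Φ rk H (Fintype.card σ) ∅ (by simp)
  have h2 := step ((kill L univ).comp Φ) (((MvPolynomial.map τ).comp (kill L univ)).comp Φ)
    (MvPolynomial.map τ) (by rw [RingHom.comp_assoc]) f (by simp [hf, hx]) (by simp [hf, hτ])
  have h3 : ((Fintype.card σ + 1 : ℕ) : ℕ∞) ≤ Order.coheight (pt ((kill L ∅).comp Φ)) := by
    refine le_trans ?_ h1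
    rw [Nat.cast_add, add_comm]
    refine add_le_add_left (le_trans ?_ h2) _
    simp
  have h4 := Order.coheight_le_krullDim (pt ((kill L ∅).comp Φ))
  refine le_trans ?_ h4
  exact WithBot.coe_le_coe.2 h3
end chain

section param
variable {S : Type} [CommRing S] {d r : ℕ}

abbrev Ix (d r : ℕ) : Type := Option (Fin d ⊕ Fin r)

def lam (Ti : S) (l : Fin d ⊕ Fin r → S) : Ix d r → S
  | none => Ti
  | some x => l x

def uu (T : S) (l v : Fin d ⊕ Fin r → S) : Ix d r → S
  | none => T * (1 - ∑ x, l x * v x)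
  | some x => v x

def ww (T : S) (l : Fin d ⊕ Fin r → S) (g : Fin d → Fin r → S) (J : Fin r) : Ix d r → S
  | none => - T * (l (Sum.inr J) + ∑ a, g a J * l (Sum.inl a))
  | some (Sum.inl a) => g a J
  | some (Sum.inr J') => if J = J' then 1 else 0

def q0 (g : Fin d → Fin r → S) : Ix d r → Fin d → S
  | none, _ => 0
  | some (Sum.inl a'), a => if a' = a then 1 else 0
  | some (Sum.inr j), a => - g a j

def qq (T Ti : S) (l v : Fin d ⊕ Fin r → S) (g : Fin d → Fin r → S) (i : Ix d r) (a : Fin d) : S :=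
  q0 g i a - lam Ti l i * ∑ m, q0 g m a * uu T l v m

def BB (T Ti : S) (l v : Fin d ⊕ Fin r → S) (g : Fin d → Fin r → S)
    (β : Fin r → Fin d → Fin d → S) (i j m : Ix d r) : S :=
  ∑ J, ww T l g J m * ∑ a, ∑ b, β J a b * qq T Ti l v g i a * qq T Ti l v g j b

lemma lam_uu {T Ti : S} (hT : T * Ti = 1) (l v : Fin d ⊕ Fin r → S) :
    ∑ m, lam Ti l m * uu T l v m = 1 := by
  rw [Fintype.sum_option]
  simp only [lam, uu]
  linear_combination (1 - ∑ x, l x * v x) * hT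

lemma ww_lam {T Ti : S} (hT : T * Ti = 1) (l : Fin d ⊕ Fin r → S) (g : Fin d → Fin r → S)
    (J : Fin r) : ∑ m, ww T l g J m * lam Ti l m = 0 := by
  rw [Fintype.sum_option, Fintype.sum_sum_type]
  simp [lam, ww]
  linear_combination -(l (Sum.inr J) + ∑ a, g a J * l (Sum.inl a)) * hT

lemma ww_q0 (T : S) (l : Fin d ⊕ Fin r → S) (g : Fin d → Fin r → S)
    (J : Fin r) (a : Fin d) : ∑ m, ww T l g J m * q0 g m a = 0 := by
  rw [Fintype.sum_option, Fintype.sum_sum_type]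
  simp [q0, ww]

lemma ww_qq {T Ti : S} (hT : T * Ti = 1) (l v : Fin d ⊕ Fin r → S) (g : Fin d → Fin r → S)
    (J : Fin r) (a : Fin d) : ∑ m, ww T l g J m * qq T Ti l v g m a = 0 := by
  simp only [qq, mul_sub, sum_sub_distrib, ww_q0, ← mul_assoc, ← sum_mul, ww_lam hT]
  simp

lemma uu_qq {T Ti : S} (hT : T * Ti = 1) (l v : Fin d ⊕ Fin r → S) (g : Fin d → Fin r → S)
    (a : Fin d) : ∑ m, uu T l v m * qq T Ti l v g m a = 0 := by
  have := lam_uu hT l v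
  simp only [fun m => mul_comm (lam Ti l m) (uu T l v m)] at this
  simp only [qq, mul_sub, sum_sub_distrib, ← mul_assoc, ← sum_mul, this]
  simp [mul_comm]

lemma contr {T Ti : S} (l v : Fin d ⊕ Fin r → S) (g : Fin d → Fin r → S)
    (β : Fin r → Fin d → Fin d → S) (x : Ix d r → S)
    (hx : ∀ a, ∑ m, x m * qq T Ti l v g m a = 0) (k p : Ix d r) :
    ∑ m, x m * BB T Ti l v g β m k p = 0 := by
  have : ∀ m, x m * BB T Ti l v g β m k p = ∑ J, ∑ a, ∑ b,
      ww T l g J p * β J a b * qq T Ti l v g k b * (x m * qq T Ti l v g m a) := by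
    intro m
    simp only [BB, mul_sum]
    refine sum_congr rfl fun J _ => sum_congr rfl fun a _ => sum_congr rfl fun b _ => ?_
    ring
  simp only [this]
  rw [sum_comm]
  refine sum_eq_zero fun J _ => ?_
  rw [sum_comm]
  refine sum_eq_zero fun a _ => ?_
  rw [sum_comm]
  refine sum_eq_zero fun b _ => ?_
  rw [← mul_sum, hx, mul_zero]

lemma contr2 {T Ti : S} (l v : Fin d ⊕ Fin r → S) (g : Fin d → Fin r → S)
    (β : Fin r → Fin d → Fin d → S) (x : Ix d r → S)
    (hx : ∀ J, ∑ m, ww T l g J m * x m = 0) (i j : Ix d r) :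
    ∑ m, BB T Ti l v g β i j m * x m = 0 := by
  simp only [BB, sum_mul]
  rw [sum_comm]
  refine sum_eq_zero fun J _ => ?_
  simp only [mul_right_comm _ _ (x _)]
  rw [← sum_mul, hx, zero_mul]

lemma good {T Ti : S} (hT : T * Ti = 1) (l v : Fin d ⊕ Fin r → S) (g : Fin d → Fin r → S)
    (β : Fin r → Fin d → Fin d → S) (hβ : ∀ J a b, β J a b = β J b a) :
    Good (lam Ti l) (uu T l v) (BB T Ti l v g β) where
  lu := lam_uu hT l v
  symm i j m := by
    unfold BB
    refine sum_congr rfl fun J _ => ?_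
    rw [sum_comm]
    congr 1
    refine sum_congr rfl fun a _ => sum_congr rfl fun b _ => ?_
    rw [hβ]; ring
  Bl i j := contr2 l v g β _ (ww_lam hT l g) i j
  BB i j k p := contr2 l v g β _ (fun J => contr l v g β _ (ww_qq hT l v g J) k p) i j
  uB k p := contr l v g β _ (uu_qq hT l v g) k p

lemma kap_qq {S' : Type} [CommRing S'] (κ : S →+* S') {T Ti : S} (l v : Fin d ⊕ Fin r → S)
    (g : Fin d → Fin r → S) (hl : ∀ x, κ (l x) = 0) (a b : Fin d) :
    κ (qq T Ti l v g (some (Sum.inl a)) b) = if a = b then 1 else 0 := by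
  simp [qq, q0, lam, hl, apply_ite κ]

lemma kap_r {S' : Type} [CommRing S'] (κ : S →+* S') {T Ti : S} (l v : Fin d ⊕ Fin r → S)
    (g : Fin d → Fin r → S) (β : Fin r → Fin d → Fin d → S)
    (hl : ∀ x, κ (l x) = 0) (a b : Fin d) (J : Fin r) :
    κ (cc (lam Ti l) (uu T l v) (BB T Ti l v g β) (some (Sum.inl a)) (some (Sum.inl b))
      (some (Sum.inr J))) = κ (β J a b) := by
  simp [cc, BB, lam, hl, kap_qq, ww]

lemma kap_d {S' : Type} [CommRing S'] (κ : S →+* S') {T Ti : S} (l v : Fin d ⊕ Fin r → S)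
    (g : Fin d → Fin r → S) (β : Fin r → Fin d → Fin d → S)
    (hl : ∀ x, κ (l x) = 0) (a b c : Fin d) :
    κ (cc (lam Ti l) (uu T l v) (BB T Ti l v g β) (some (Sum.inl a)) (some (Sum.inl b))
      (some (Sum.inl c))) = ∑ J, κ (g c J) * κ (β J a b) := by
  simp [cc, BB, lam, hl, kap_qq, ww]
  split_ifs <;> simp [hl]
end param

section main
variable {k S : Type} [CommRing k] [CommRing S] [Algebra k S] {n : ℕ} {I : Type} [Fintype I]
  [DecidableEq I]

noncomputable def Phi (e : Fin n ≃ I) {la u : I → S} {B : I → I → I → S} (h : Good la u B) :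
    Rring k n →+* S :=
  Ideal.Quotient.lift _ (MvPolynomial.aeval (R := k) (Sum.elim
    (fun t : Fin n × Fin n × Fin n => cc la u B (e t.1) (e t.2.1) (e t.2.2))
    (fun i => u (e i)))).toRingHom (by
    intro x hx
    rw [← RingHom.mem_ker]
    revert x
    change Ideal.span _ ≤ _
    rw [Ideal.span_le]
    rintro x ((⟨t, rfl⟩ | ⟨t, rfl⟩) | ⟨t, rfl⟩)
    · simp [RingHom.mem_ker, h.comm (e t.1)]
    · have := h.assoc (e t.1) (e t.2.1) (e t.2.2.1) (e t.2.2.2)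
      rw [← e.sum_comp, ← e.sum_comp] at this
      simp [RingHom.mem_ker, this]
    · have := h.unit (e t.1) (e t.2)
      rw [← e.sum_comp] at this
      by_cases ht : t.1 = t.2
      · rw [ht] at this
        simp [RingHom.mem_ker, this, ht]
      · simp [RingHom.mem_ker, this, ht])

noncomputable def cR (k : Type) [CommRing k] (e : Fin n ≃ I) (i j l : I) : Rring k n :=
  Ideal.Quotient.mk _ (MvPolynomial.X (Sum.inl (e.symm i, e.symm j, e.symm l)))

noncomputable def uR (k : Type) [CommRing k] (e : Fin n ≃ I) (i : I) : Rring k n :=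
  Ideal.Quotient.mk _ (MvPolynomial.X (Sum.inr (e.symm i)))

lemma Phi_c (e : Fin n ≃ I) {la u : I → S} {B : I → I → I → S} (h : Good la u B) (i j l : I) :
    Phi (k := k) e h (cR k e i j l) = cc la u B i j l := by
  simp [Phi, cR]

lemma Phi_u (e : Fin n ≃ I) {la u : I → S} {B : I → I → I → S} (h : Good la u B) (i : I) :
    Phi (k := k) e h (uR k e i) = u i := by
  simp [Phi, uR]
end main

abbrev Sg (d r : ℕ) : Type :=
  (Fin d ⊕ Fin r) ⊕ (Fin d ⊕ Fin r) ⊕ (Fin r × Sym2 (Fin d)) ⊕ (Fin d × Fin r)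

def rk {d r : ℕ} : Sg d r → ℕ
  | Sum.inl _ => 0
  | Sum.inr (Sum.inl _) => 1
  | Sum.inr (Sum.inr (Sum.inl _)) => 2
  | Sum.inr (Sum.inr (Sum.inr _)) => 3

lemma main (k : Type) [Field k] (d r : ℕ) (p : Fin r ↪ Sym2 (Fin d)) :
    ((Fintype.card (Sg d r) + 1 : ℕ) : WithBot (WithTop ℕ)) ≤ ringKrullDim (Rring k (1 + d + r)) := by
  classical
  let L := LaurentPolynomial k
  let P := MvPolynomial (Sg d r) L
  let e : Fin (1 + d + r) ≃ Ix d r := Fintype.equivOfCardEq (by simp; ring)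
  let T : P := MvPolynomial.C (LaurentPolynomial.T 1)
  let Ti : P := MvPolynomial.C (LaurentPolynomial.T (-1))
  have hT : T * Ti = 1 := by
    change MvPolynomial.C _ * MvPolynomial.C _ = _
    rw [← map_mul, ← LaurentPolynomial.T_add]; simp
  let l : Fin d ⊕ Fin r → P := fun x => MvPolynomial.X (Sum.inl x)
  let v : Fin d ⊕ Fin r → P := fun x => MvPolynomial.X (Sum.inr (Sum.inl x))
  let g : Fin d → Fin r → P := fun a J => MvPolynomial.X (Sum.inr (Sum.inr (Sum.inr (a, J))))
  let β : Fin r → Fin d → Fin d → P := fun J a b => (if s(a, b) = p J then 1 else 0) +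
    MvPolynomial.X (Sum.inr (Sum.inr (Sum.inl (J, s(a, b)))))
  have hβ : ∀ J a b, β J a b = β J b a := by
    intro J a b; simp only [β, Sym2.eq_swap]
  have G := good hT l v g β hβ
  refine chain (Phi (k := k) e G) rk ?_
    (LaurentPolynomial.eval₂ (RingHom.id k) (1 : kˣ)) (uR k e none - 1) (LaurentPolynomial.T 1 - 1)
    ?_ ?_ ?_
  · rintro (x | x | ⟨J, z⟩ | ⟨a, J⟩)
    · refine ⟨(Matrix.of fun m y => cR k e (some x) m y).det, Fintype.card (Ix d r),
        Fintype.card_ne_zero, fun K _ => ?_⟩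
      rw [RingHom.map_det, ← map_pow]
      congr 1
      rw [← show lam Ti l (some x) = MvPolynomial.X (Sum.inl x) from rfl, ← G.det]
      congr 1
      ext1 m y
      simp [Phi_c]
    · refine ⟨uR k e (some x), 1, one_ne_zero, fun K _ => ?_⟩
      rw [Phi_u, pow_one]; rfl
    · induction z with
      | h a b =>
        refine ⟨cR k e (some (Sum.inl a)) (some (Sum.inl b)) (some (Sum.inr J)) -
          (if s(a, b) = p J then 1 else 0), 1, one_ne_zero, fun K hK => ?_⟩
        rw [map_sub, Phi_c, map_sub, kap_r _ _ _ _ _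
          (fun x => by rw [kill_X, if_pos]; exact hK _ (by simp [rk]))]
        simp only [β]
        split_ifs <;> simp
    · obtain ⟨⟨a', b'⟩, hz⟩ := Sym2.mk_surjective (p J)
      change s(a', b') = p J at hz
      refine ⟨cR k e (some (Sum.inl a')) (some (Sum.inl b')) (some (Sum.inl a)), 1, one_ne_zero,
        fun K hK => ?_⟩
      rw [Phi_c, kap_d _ _ _ _ _
          (fun x => by rw [kill_X, if_pos]; exact hK _ (by simp [rk]))]
      have : ∀ J', kill L K (β J' a' b') = if J' = J then 1 else 0 := by
        intro J'
        simp only [β, map_add, kill_X]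
        rw [if_pos (hK _ (by simp [rk])), hz]
        simp [p.injective.eq_iff, eq_comm, apply_ite]
      simp only [this]
      simp [g]
  · rw [sub_ne_zero]
    intro h
    rw [← Polynomial.toLaurent_X, ← Polynomial.toLaurent_one] at h
    have h2 := congrArg (Polynomial.eval 0) (Polynomial.toLaurent_injective h)
    simp at h2
  · rw [map_sub, map_one]
    have := LaurentPolynomial.eval₂_T (RingHom.id k) (1 : kˣ) 1
    rw [sub_eq_zero]
    exact this.trans (by simp)
  · rw [map_sub, Phi_u]
    simp [uu, T, l, kill_X, kill_C]
end BA

/-- If `r ≤ d(d+1)/2` and `n = 1 + d + r`, then the Krull dimension of `R_n(k)` is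
at least `r(d(d+1)/2 - r) + n² - (d² + dr)`. -/
theorem stmt5 (k : Type) [Field k] (n d r : ℕ)
    (hr : (r : ℚ) ≤ (d : ℚ) * ((d : ℚ) + 1) / 2) (hn : n = 1 + d + r) :
    ∃ m : ℕ,
      (r : ℚ) * ((d : ℚ) * ((d : ℚ) + 1) / 2 - (r : ℚ)) + (n : ℚ) ^ 2
          - ((d : ℚ) ^ 2 + (d : ℚ) * (r : ℚ)) ≤ (m : ℚ) ∧
      (m : WithBot (WithTop ℕ)) ≤ ringKrullDim (Rring k n) := by
  subst hn
  have hc : (Fintype.card (Sym2 (Fin d)) : ℚ) = (d : ℚ) * ((d : ℚ) + 1) / 2 := by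
    rw [Sym2.card, Nat.cast_choose_two, Fintype.card_fin]; push_cast; ring
  have hle : Fintype.card (Fin r) ≤ Fintype.card (Sym2 (Fin d)) := by
    rw [Fintype.card_fin]
    rw [← hc] at hr
    exact_mod_cast hr
  obtain ⟨p⟩ := Function.Embedding.nonempty_of_card_le hle
  refine ⟨_, ?_, BA.main k d r p⟩
  simp only [Fintype.card_sum, Fintype.card_prod, Fintype.card_fin]
  push_cast
  rw [hc]
  apply le_of_eq
  ring
end

section
/- For every field k and every integer n ≥ 8, the prime spectrum of R_n(k) is not an irreducible topological space (equivalently, R_n(k) has more than one minimal prime ideal); that is, the variety B_{n,k} is reducible. -/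
section
variable {ι S T : Type*} [Fintype ι] [CommRing S] [CommRing T]

def dlt (c : ι → ι → ι → S) : (ι × ι → S) →ₗ[S] (ι × ι × ι → S) where
  toFun H := fun t => ∑ m, H (t.2.1, m) * c t.1 m t.2.2 - ∑ m, c t.1 t.2.1 m * H (m, t.2.2)
    + ∑ m, H (t.1, m) * c m t.2.1 t.2.2
  map_add' H K := by
    funext t
    simp only [Pi.add_apply, add_mul, mul_add, Finset.sum_add_distrib]
    ring
  map_smul' r H := by
    funext t
    simp only [Pi.smul_apply, smul_eq_mul, RingHom.id_apply, mul_add, mul_sub, Finset.mul_sum,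
      mul_assoc, mul_left_comm]

def coc (c : ι → ι → ι → S) : (ι × ι × ι → S) →ₗ[S] (ι × ι × ι × ι → S) where
  toFun p := fun t =>
    ∑ m, p (t.2.1, t.2.2.1, m) * c t.1 m t.2.2.2 - ∑ m, c t.1 t.2.1 m * p (m, t.2.2.1, t.2.2.2)
    + ∑ m, c t.2.1 t.2.2.1 m * p (t.1, m, t.2.2.2) - ∑ m, p (t.1, t.2.1, m) * c m t.2.2.1 t.2.2.2
  map_add' H K := by
    funext t
    simp only [Pi.add_apply, add_mul, mul_add, Finset.sum_add_distrib]
    ring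
  map_smul' r H := by
    funext t
    simp only [Pi.smul_apply, smul_eq_mul, RingHom.id_apply, mul_add, mul_sub, Finset.mul_sum,
      mul_assoc, mul_left_comm]

def sys (c : ι → ι → ι → S) (fn : ι × ι → Option (ι × ι × ι)) :
    (ι × ι × ι → S) →ₗ[S] ((ι × ι × ι × ι) ⊕ (ι × ι × ι) ⊕ (ι × ι) → S) where
  toFun p := Sum.elim (coc c p) (Sum.elim (fun t => p t - p (t.2.1, t.1, t.2.2))
    (fun t => (fn t).elim 0 p))
  map_add' p q := by
    funext t
    rcases t with t | t | t
    · simp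
    · simp; ring
    · simp; cases fn t <;> simp
  map_smul' r p := by
    funext t
    rcases t with t | t | t
    · simp
    · simp; ring
    · simp; cases fn t <;> simp

lemma dlt_map (φ : S →+* T) (c : ι → ι → ι → S) (H : ι × ι → S) :
    φ ∘ dlt c H = dlt (fun i j l => φ (c i j l)) (φ ∘ H) := by
  funext t
  simp [dlt]

lemma sys_map (φ : S →+* T) (c : ι → ι → ι → S) (fn) (p : ι × ι × ι → S) :
    φ ∘ sys c fn p = sys (fun i j l => φ (c i j l)) fn (φ ∘ p) := by
  funext t
  rcases t with t | t | t
  · simp [sys, coc]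
  · simp [sys]
  · simp [sys]; cases fn t <;> simp

lemma coc_dlt (c : ι → ι → ι → S)
    (ha : ∀ i j k l, ∑ m, c i j m * c m k l = ∑ m, c j k m * c i m l) (H : ι × ι → S) :
    coc c (dlt c H) = 0 := by
  funext ⟨i, j, k, l⟩
  have h1 : ∑ s, H (j, s) * (∑ m, c i s m * c m k l - ∑ m, c s k m * c i m l) = 0 := by
    simp [ha]
  have h2 : ∑ s, H (k, s) * (∑ m, c i j m * c m s l - ∑ m, c j s m * c i m l) = 0 := by
    simp [ha]
  have h3 : ∑ s, H (i, s) * (∑ m, c s j m * c m k l - ∑ m, c j k m * c s m l) = 0 := by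
    simp [ha]
  have h4 : ∑ s, H (s, l) * (∑ m, c i j m * c m k s - ∑ m, c j k m * c i m s) = 0 := by
    simp [ha]
  simp only [mul_sub, Finset.mul_sum, Finset.sum_sub_distrib] at h1 h2 h3 h4
  simp only [coc, dlt, LinearMap.coe_mk, AddHom.coe_mk, Pi.zero_apply, mul_add, add_mul, sub_mul,
    mul_sub, Finset.mul_sum, Finset.sum_mul, Finset.sum_sub_distrib, Finset.sum_add_distrib]
  have e1 : ∑ x, ∑ y, H (j, y) * c y k x * c i x l = ∑ x, ∑ y, H (j, x) * (c x k y * c i y l) := by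
    rw [Finset.sum_comm]; simp only [mul_assoc]
  have e2 : ∑ x, ∑ y, H (k, y) * c j y x * c i x l = ∑ x, ∑ y, H (k, x) * (c j x y * c i y l) := by
    rw [Finset.sum_comm]; simp only [mul_assoc]
  have e3 : ∑ x, ∑ y, c j k y * H (y, x) * c i x l = ∑ x, ∑ y, c j k x * (H (x, y) * c i y l) := by
    rw [Finset.sum_comm]; simp only [mul_assoc]
  have e4 : ∑ x, ∑ y, c i j x * (H (k, y) * c x y l) = ∑ x, ∑ y, H (k, x) * (c i j y * c y x l) := by
    rw [Finset.sum_comm]; simp only [mul_left_comm]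
  have e5 : ∑ x, ∑ y, c i j x * (c x k y * H (y, l)) = ∑ x, ∑ y, H (x, l) * (c i j y * c y k x) := by
    rw [Finset.sum_comm]; refine Finset.sum_congr rfl fun _ _ => Finset.sum_congr rfl fun _ _ => by ring
  have e6 : ∑ x, ∑ y, c j k x * (c i x y * H (y, l)) = ∑ x, ∑ y, H (x, l) * (c j k y * c i y x) := by
    rw [Finset.sum_comm]; refine Finset.sum_congr rfl fun _ _ => Finset.sum_congr rfl fun _ _ => by ring
  have e7 : ∑ x, ∑ y, c j k x * (H (i, y) * c y x l) = ∑ x, ∑ y, H (i, x) * (c j k y * c x y l) := by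
    rw [Finset.sum_comm]; simp only [mul_left_comm]
  have e8 : ∑ x, ∑ y, H (j, y) * c i y x * c x k l = ∑ x, ∑ y, H (j, x) * (c i x y * c y k l) := by
    rw [Finset.sum_comm]; simp only [mul_assoc]
  have e9 : ∑ x, ∑ y, H (i, y) * c y j x * c x k l = ∑ x, ∑ y, H (i, x) * (c x j y * c y k l) := by
    rw [Finset.sum_comm]; simp only [mul_assoc]
  have e10 : ∑ x, ∑ y, c i j y * H (y, x) * c x k l = ∑ x, ∑ y, c i j x * (H (x, y) * c y k l) := by
    rw [Finset.sum_comm]; simp only [mul_assoc]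
  rw [e1, e2, e3, e4, e5, e6, e7, e8, e9, e10]
  linear_combination h4 - h1 - h2 - h3

lemma dlt_symm (c : ι → ι → ι → S) (hc : ∀ i j l, c i j l = c j i l) (H : ι × ι → S) (i j l) :
    dlt c H (i, j, l) = dlt c H (j, i, l) := by
  simp only [dlt, LinearMap.coe_mk, AddHom.coe_mk]
  have h1 : ∀ m, c i m l = c m i l := fun m => hc _ _ _
  have h2 : ∀ m, c j m l = c m j l := fun m => hc _ _ _
  have h3 : ∀ m, c i j m = c j i m := fun m => hc _ _ _
  simp only [h1, h2, h3]
  ring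

lemma sc {k R F I J : Type*} [Field k] [CommRing R] [Field F] [Algebra k R] (ψ : R →ₐ[k] k)
    (φ : R →+* F) (hφ : Function.Injective φ) [Fintype I] [Fintype J] [DecidableEq I]
    [DecidableEq J] (f : (J → R) →ₗ[R] (I → R)) (f0 : (J → k) →ₗ[k] (I → k))
    (f1 : (J → F) →ₗ[F] (I → F)) (h0 : ∀ v, ψ ∘ f v = f0 (ψ ∘ v)) (h1 : ∀ v, φ ∘ f v = f1 (φ ∘ v))
    (hinj : Function.Injective f0) : Function.Injective f1 := by
  obtain ⟨g, hg⟩ := f0.exists_leftInverse_of_injective (LinearMap.ker_eq_bot.2 hinj)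
  set M := LinearMap.toMatrix' f with hM
  have hM0 : M.map ψ = LinearMap.toMatrix' f0 := by
    ext i j
    have := congrFun (h0 (Pi.single j 1)) i
    simp only [Function.comp_apply] at this
    simp only [hM, Matrix.map_apply, LinearMap.toMatrix'_apply]
    convert this using 2
    · ext a; simp [Pi.single_apply, apply_ite]
  have hM1 : M.map φ = LinearMap.toMatrix' f1 := by
    ext i j
    have := congrFun (h1 (Pi.single j 1)) i
    simp only [Function.comp_apply] at this
    simp only [hM, Matrix.map_apply, LinearMap.toMatrix'_apply]
    convert this using 2
    · ext a; simp [Pi.single_apply, apply_ite]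
  set L := LinearMap.toMatrix' g with hL
  have hLM : L * M.map ψ = 1 := by
    rw [hM0, hL, ← LinearMap.toMatrix'_comp, hg, LinearMap.toMatrix'_id]
  let N : Matrix J J R := L.map (algebraMap k R) * M
  have hd : ψ N.det = 1 := by
    have : N.map ψ = 1 := by
      rw [← hLM]
      simp only [N]
      rw [Matrix.map_mul]
      congr 1
      ext i j; simp
    have h2 : ψ N.det = (N.map ψ).det := by
      have := RingHom.map_det (ψ : R →+* k) N
      simpa using this
    rw [h2, this, Matrix.det_one]
  have hne : N.det ≠ 0 := by
    intro h; rw [h] at hd; simp at hd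
  have hdF : (N.map φ).det ≠ 0 := by
    have h2 : φ N.det = (N.map φ).det := by
      have := RingHom.map_det φ N
      simpa using this
    rw [← h2]
    exact fun h => hne (hφ (by simpa using h))
  have hN : N.map φ = (L.map (algebraMap k R)).map φ * M.map φ := Matrix.map_mul
  have hu : IsUnit (N.map φ) := (Matrix.isUnit_iff_isUnit_det _).2 (isUnit_iff_ne_zero.2 hdF)
  have hi := Matrix.mulVec_injective_iff_isUnit.2 hu
  intro v w hvw
  apply hi
  rw [hN, ← Matrix.mulVec_mulVec, ← Matrix.mulVec_mulVec, hM1, LinearMap.toMatrix'_mulVec,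
    LinearMap.toMatrix'_mulVec, hvw]

/-- The core contradiction. -/
lemma core [DecidableEq ι] {k R : Type*} [Field k] [CommRing R] [IsDomain R] [Algebra k R]
    (ψ0 ψ1 : R →ₐ[k] k) (c : ι → ι → ι → R) (hc : ∀ i j l, c i j l = c j i l)
    (ha : ∀ i j k l, ∑ m, c i j m * c m k l = ∑ m, c j k m * c i m l)
    (fn : ι × ι → Option (ι × ι × ι)) (t0 : ι × ι) (ht0 : fn t0 = none)
    (H0 : Function.Injective (sys (fun i j l => ψ0 (c i j l)) fn))
    (H1 : Function.Injective (dlt (fun i j l => ψ1 (c i j l)))) : False := by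
  let F := FractionRing R
  let φ : R →+* F := algebraMap R F
  have hφ : Function.Injective φ := IsFractionRing.injective R F
  have G0 := sc ψ0 φ hφ (sys c fn) _ (sys (fun i j l => φ (c i j l)) fn)
    (fun v => sys_map (ψ0 : R →+* k) c fn v) (fun v => sys_map φ c fn v) H0
  have G1 := sc ψ1 φ hφ (dlt c) _ (dlt (fun i j l => φ (c i j l)))
    (fun v => dlt_map (ψ1 : R →+* k) c v) (fun v => dlt_map φ c v) H1
  set cF : ι → ι → ι → F := fun i j l => φ (c i j l) with hcF
  have hcs : ∀ i j l, cF i j l = cF j i l := fun i j l => by simp only [hcF, hc i j l]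
  have has : ∀ i j k l, ∑ m, cF i j m * cF m k l = ∑ m, cF j k m * cF i m l := fun i j k l => by
    simp only [hcF, ← map_mul, ← map_sum, ha i j k l]
  let e : (ι × ι → F) →ₗ[F] (ι × ι → F) :=
    (LinearMap.pi fun t => LinearMap.proj (Sum.inr (Sum.inr t))) ∘ₗ sys cF fn ∘ₗ dlt cF
  have he : Function.Injective e := by
    intro v w hvw
    apply G1
    apply G0
    funext t
    rcases t with t | t | t
    · change coc cF (dlt cF v) t = coc cF (dlt cF w) t
      rw [coc_dlt cF has, coc_dlt cF has]
    · obtain ⟨i, j, l⟩ := t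
      change dlt cF v (i, j, l) - dlt cF v (j, i, l) = dlt cF w (i, j, l) - dlt cF w (j, i, l)
      rw [dlt_symm cF hcs v, dlt_symm cF hcs w, sub_self, sub_self]
    · exact congrFun hvw t
  obtain ⟨v, hv⟩ := (LinearMap.injective_iff_surjective.1 he) (fun _ => 1)
  have := congrFun hv t0
  change (fn t0).elim 0 (dlt cF v) = 1 at this
  rw [ht0] at this
  simp at this

lemma dlt_inj_diag [DecidableEq ι] {k : Type*} [Field k] :
    Function.Injective (dlt (fun i j l : ι => if i = j ∧ j = l then (1 : k) else 0)) := by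
  rw [← LinearMap.ker_eq_bot, LinearMap.ker_eq_bot']
  intro H hH
  funext ⟨i, l⟩
  by_cases h : i = l
  · subst h
    have := congrFun hH (i, i, i)
    simpa [dlt, ite_and] using this
  · have := congrFun hH (i, i, l)
    simpa [dlt, h, ite_and] using this

end
section
def tab : Fin 8 → Fin 8 → Option (Fin 8) := fun i j =>
  if i = 0 then some j else if j = 0 then some i else
  if (i = 1 ∧ j = 3) ∨ (i = 3 ∧ j = 1) then some 5 else
  if (i = 1 ∧ j = 4) ∨ (i = 4 ∧ j = 1) ∨ (i = 2 ∧ j = 3) ∨ (i = 3 ∧ j = 2) then some 6 else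
  if (i = 2 ∧ j = 4) ∨ (i = 4 ∧ j = 2) then some 7 else none

def c8 (k : Type*) [Field k] (i j l : Fin 8) : k := if tab i j = some l then 1 else 0

lemma local_zero {k : Type*} [Field k] (p : Fin 8 → Fin 8 → Fin 8 → k)
    (hs : ∀ i j l, p i j l = p j i l)
    (E : ∀ i j q l, ∑ m, p j q m * c8 k i m l - ∑ m, c8 k i j m * p m q l
      + ∑ m, c8 k j q m * p i m l - ∑ m, p i j m * c8 k m q l = 0)
    (h0 : ∀ b l, p 0 b l = 0) (h5 : ∀ l, p 1 3 l = 0) (h6 : ∀ l, p 1 4 l = 0)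
    (h7 : ∀ l, p 2 4 l = 0) (h12 : ∀ l, p 1 2 l = 0) (h34 : ∀ l, p 3 4 l = 0)
    (hW : ∀ l : Fin 8, 5 ≤ l → p 1 1 l = 0 ∧ p 2 2 l = 0 ∧ p 3 3 l = 0 ∧ p 4 4 l = 0 ∧ p 2 3 l = 0) :
    ∀ i j l, p i j l = 0 := by
  have h0' : ∀ b l, p b 0 l = 0 := fun b l => by rw [hs, h0]
  have h5' : ∀ l, p 3 1 l = 0 := fun l => by rw [hs, h5]
  have h6' : ∀ l, p 4 1 l = 0 := fun l => by rw [hs, h6]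
  have h7' : ∀ l, p 4 2 l = 0 := fun l => by rw [hs, h7]
  have h12' : ∀ l, p 2 1 l = 0 := fun l => by rw [hs, h12]
  have h34' : ∀ l, p 4 3 l = 0 := fun l => by rw [hs, h34]
  have h32 : ∀ l, p 3 2 l = p 2 3 l := fun l => hs _ _ _
  have W5 := hW 5 (by decide)
  have W6 := hW 6 (by decide)
  have W7 := hW 7 (by decide)
  simp only [c8, Fin.sum_univ_eight] at E
  have A (l) := E 2 1 1 l
  have B (l) := E 1 2 2 l
  have C (l) := E 4 3 3 l
  have D (l) := E 3 4 4 l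
  have A1 (l) := E 1 2 3 l
  have A2 (l) := E 1 1 4 l
  have B1 (l) := E 2 2 3 l
  have B2 (l) := E 2 1 4 l
  have C1 (l) := E 3 3 2 l
  have C2 (l) := E 3 4 1 l
  have D1 (l) := E 4 3 2 l
  have D2 (l) := E 4 4 1 l
  simp [tab, h0, h0', h5, h6, h7, h5', h6', h7', h12, h34, h12', h34', h32] at A B C D A1 A2 B1 B2 C1 C2 D1 D2
  have a1 := A 2; have a2 := A 6; have a3 := A 7
  have b1 := B 1; have b2 := B 5; have b3 := B 6
  have c1 := C 4; have c2 := C 6; have c3 := C 7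
  have d1 := D 3; have d2 := D 5; have d3 := D 6
  have e1 := A1 1; have e2 := A1 5; have e3 := A1 6; have e4 := A1 7
  have f1 := A2 1; have f2 := A2 5; have f3 := A2 6; have f4 := A2 7
  have g1 := B1 5; have g2 := B1 6; have g3 := B1 7
  have i1 := C1 5; have i2 := C1 6; have i3 := C1 7
  have j1 := D1 5; have j2 := D1 6; have j3 := D1 7
  have k1 := D2 5; have k2 := D2 6; have k3 := D2 7
  simp [B2, C2] at a1 a2 a3 b1 b2 b3 c1 c2 c3 d1 d2 d3 e1 e2 e3 e4 f1 f2 f3 f4 g1 g2 g3 i1 i2 i3 j1 j2 j3 k1 k2 k3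
  clear A B C D A1 A2 B1 B2 C1 C2 D1 D2
  have q0 : p 2 3 0 = 0 := by linear_combination e1 - f1
  have q3 : p 2 3 3 = 0 := by linear_combination e2 - f2
  have a5 : p 1 1 2 = 0 := by linear_combination e4 - f4
  have b5 : p 2 2 2 = 0 := by linear_combination q3 - g2
  have q4 : p 2 3 4 = 0 := g3
  have a4 : p 1 1 1 = 0 := by linear_combination e3 - f3 - q4
  have q1 : p 2 3 1 = 0 := i1
  have d4 : p 4 4 3 = 0 := by linear_combination j1 - k1
  have d5 : p 4 4 4 = 0 := by linear_combination j2 - k2 - q1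
  have q2 : p 2 3 2 = 0 := by linear_combination j3 - k3
  have c5 : p 3 3 3 = 0 := by linear_combination q2 - i2
  have V11 : ∀ l, p 1 1 l = 0 := by
    intro l; fin_cases l <;> simp [*]
  have V22 : ∀ l, p 2 2 l = 0 := by
    intro l; fin_cases l <;> simp [*]
  have V33 : ∀ l, p 3 3 l = 0 := by
    intro l; fin_cases l <;> simp [*]
  have V44 : ∀ l, p 4 4 l = 0 := by
    intro l; fin_cases l <;> simp [*]
  have V23 : ∀ l, p 2 3 l = 0 := by
    intro l; fin_cases l <;> simp [*]
  have V32 : ∀ l, p 3 2 l = 0 := fun l => by rw [hs, V23]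
  have r51 (l) := E 3 1 1 l
  have r52 (l) := E 3 1 2 l
  have r53 (l) := E 1 3 3 l
  have r54 (l) := E 1 3 4 l
  have r61 (l) := E 4 1 1 l
  have r62 (l) := E 4 1 2 l
  have r63 (l) := E 1 4 3 l
  have r64 (l) := E 1 4 4 l
  have r71 (l) := E 4 2 1 l
  have r72 (l) := E 4 2 2 l
  have r73 (l) := E 2 4 3 l
  have r74 (l) := E 2 4 4 l
  simp [tab, h0, h0', h5, h6, h7, h5', h6', h7', h12, h34, h12', h34', V11, V22, V33, V44, V23, V32]
    at r51 r52 r53 r54 r61 r62 r63 r64 r71 r72 r73 r74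
  have s15 (l) : p 1 5 l = 0 := by rw [hs, r51]
  have s25 (l) : p 2 5 l = 0 := by rw [hs, r52]
  have s35 (l) : p 3 5 l = 0 := by rw [hs, r53]
  have s45 (l) : p 4 5 l = 0 := by rw [hs, r54]
  have s16 (l) : p 1 6 l = 0 := by rw [hs, r61]
  have s26 (l) : p 2 6 l = 0 := by rw [hs, r62]
  have s36 (l) : p 3 6 l = 0 := by rw [hs, r63]
  have s46 (l) : p 4 6 l = 0 := by rw [hs, r64]
  have s17 (l) : p 1 7 l = 0 := by rw [hs, r71]
  have s27 (l) : p 2 7 l = 0 := by rw [hs, r72]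
  have s37 (l) : p 3 7 l = 0 := by rw [hs, r73]
  have s47 (l) : p 4 7 l = 0 := by rw [hs, r74]
  have t55 (l) := E 1 3 5 l
  have t56 (l) := E 1 3 6 l
  have t57 (l) := E 1 3 7 l
  have t66 (l) := E 1 4 6 l
  have t67 (l) := E 1 4 7 l
  have t77 (l) := E 2 4 7 l
  simp [tab, h0, h0', h5, h6, h7, s15, s25, s35, s45, s16, s26, s36, s46, s17, s27, s37, s47]
    at t55 t56 t57 t66 t67 t77
  have t65 (l) : p 6 5 l = 0 := by rw [hs, t56]
  have t75 (l) : p 7 5 l = 0 := by rw [hs, t57]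
  have t76 (l) : p 7 6 l = 0 := by rw [hs, t67]
  clear E hs
  intro i j l
  fin_cases i <;> fin_cases j <;> simp [*]

variable {m : ℕ}

def c0 (k : Type*) [Field k] (m : ℕ) : Fin 8 ⊕ Fin m → Fin 8 ⊕ Fin m → Fin 8 ⊕ Fin m → k
  | .inl i, .inl j, .inl l => c8 k i j l
  | .inr i, .inr j, .inr l => if i = j ∧ j = l then 1 else 0
  | _, _, _ => 0

def d0 (k : Type*) [Field k] (m : ℕ) : Fin 8 ⊕ Fin m → k
  | .inl i => if i = 0 then 1 else 0
  | .inr _ => 1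

lemma c0_comm (k : Type*) [Field k] (m : ℕ) (i j l) : c0 k m i j l = c0 k m j i l := by
  have h : ∀ i j, tab i j = tab j i := by decide
  rcases i with i | i <;> rcases j with j | j <;> rcases l with l | l <;> simp only [c0, c8]
  · rw [h i j]
  · grind

lemma c0_unit (k : Type*) [Field k] (m : ℕ) (j l) :
    ∑ i, d0 k m i * c0 k m i j l = if j = l then 1 else 0 := by
  rcases j with j | j <;> rcases l with l | l <;> simp [c0, c8, d0, tab, ite_and]

lemma c8_assoc (k : Type*) [Field k] (i j q l : Fin 8) :
    ∑ m, c8 k i j m * c8 k m q l = ∑ m, c8 k j q m * c8 k i m l := by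
  have h : ∀ i j q : Fin 8, ((tab i j).bind fun m => tab m q) = (tab j q).bind fun m => tab i m := by
    decide
  have h1 : ∑ m, c8 k i j m * c8 k m q l = if ((tab i j).bind fun m => tab m q) = some l then 1 else 0 := by
    cases ht : tab i j
    · simp [c8, ht]
    · simp only [c8, ht, Option.some.injEq, ite_mul, one_mul, zero_mul, Finset.sum_ite_eq,
        Finset.mem_univ, if_true, Option.bind_some]
  have h2 : ∑ m, c8 k j q m * c8 k i m l = if ((tab j q).bind fun m => tab i m) = some l then 1 else 0 := by
    cases ht : tab j q
    · simp [c8, ht]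
    · simp only [c8, ht, Option.some.injEq, ite_mul, one_mul, zero_mul, Finset.sum_ite_eq,
        Finset.mem_univ, if_true, Option.bind_some]
  rw [h1, h2, h]

lemma c0_assoc (k : Type*) [Field k] (m : ℕ) (i j q l) :
    ∑ s, c0 k m i j s * c0 k m s q l = ∑ s, c0 k m j q s * c0 k m i s l := by
  rcases i with i | i <;> rcases j with j | j <;> rcases q with q | q <;> rcases l with l | l <;>
    simp [c0, ite_and]
  · exact c8_assoc k i j q l
  · grind

def fn8 (b l : Fin 8) : Option (Fin 8 × Fin 8 × Fin 8) :=
  match b with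
  | 0 => some (0, 0, l)
  | 1 => some (1, 2, l)
  | 2 => some (3, 4, l)
  | 3 => ![some (1, 1, 5), some (1, 1, 6), some (1, 1, 7), some (2, 2, 5), some (2, 2, 6),
      some (2, 2, 7), some (3, 3, 5), some (3, 3, 6)] l
  | 4 => ![some (4, 4, 5), some (4, 4, 6), some (4, 4, 7), some (2, 3, 5), some (2, 3, 6),
      some (2, 3, 7), some (3, 3, 7), none] l
  | 5 => some (1, 3, l)
  | 6 => some (1, 4, l)
  | 7 => some (2, 4, l)

def fn0 (m : ℕ) : (Fin 8 ⊕ Fin m) × (Fin 8 ⊕ Fin m) →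
    Option ((Fin 8 ⊕ Fin m) × (Fin 8 ⊕ Fin m) × (Fin 8 ⊕ Fin m))
  | (b, .inr g) => some (.inr g, b, .inr g)
  | (.inr f, .inl l) => some (.inl 0, .inr f, .inl l)
  | (.inl b, .inl l) => (fn8 b l).map fun t => (.inl t.1, .inl t.2.1, .inl t.2.2)

lemma sys_inj (k : Type*) [Field k] (m : ℕ) : Function.Injective (sys (c0 k m) (fn0 m)) := by
  rw [← LinearMap.ker_eq_bot, LinearMap.ker_eq_bot']
  intro p hp
  have E : ∀ i j q l, ∑ s, p (j, q, s) * c0 k m i s l - ∑ s, c0 k m i j s * p (s, q, l)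
      + ∑ s, c0 k m j q s * p (i, s, l) - ∑ s, p (i, j, s) * c0 k m s q l = 0 := fun i j q l =>
    congrFun hp (Sum.inl (i, j, q, l))
  have hs : ∀ i j l, p (i, j, l) = p (j, i, l) := fun i j l =>
    sub_eq_zero.1 (congrFun hp (Sum.inr (Sum.inl (i, j, l))))
  have hf : ∀ t, (fn0 m t).elim 0 p = 0 := fun t => congrFun hp (Sum.inr (Sum.inr t))
  have F1 : ∀ b g, p (.inr g, b, .inr g) = 0 := fun b g => by
    have := hf (b, .inr g); simpa [fn0] using this
  have F2 : ∀ f l, p (.inl 0, .inr f, .inl l) = 0 := fun f l => by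
    have := hf (.inr f, .inl l); simpa [fn0] using this
  have F3 : ∀ b l t, fn8 b l = some t → p (.inl t.1, .inl t.2.1, .inl t.2.2) = 0 := fun b l t h => by
    have := hf (.inl b, .inl l); simpa [fn0, h] using this
  -- components along the idempotents
  have Z1 : ∀ a b g, p (a, b, .inr g) = 0 := by
    intro a b g
    have := E (.inr g) a b (.inr g)
    rcases a with a | a <;> rcases b with b | b <;>
      simp [c0, ite_and, F1] at this <;> grind
  have F00 : ∀ l, p (.inl 0, .inl 0, .inl l) = 0 := fun l => F3 0 l (0, 0, l) rfl
  have Z2 : ∀ b l, p (.inl 0, b, l) = 0 := by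
    intro b l
    rcases l with l | l
    · rcases b with b | b
      · have := E (.inl 0) (.inl 0) (.inl b) (.inl l)
        simpa [c0, c8, tab, F00] using this
      · exact F2 b l
    · exact Z1 _ _ _
  have Z3 : ∀ f b l, p (.inr f, b, l) = 0 := by
    intro f b l
    rcases l with l | l
    · have := E (.inl 0) (.inr f) b (.inl l)
      simpa [c0, c8, tab, Z2] using this
    · exact Z1 _ _ _
  have key := local_zero (fun i j l => p (.inl i, .inl j, .inl l)) (fun i j l => hs _ _ _)
    (fun i j q l => by
      have := E (.inl i) (.inl j) (.inl q) (.inl l)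
      simpa [c0] using this) (fun b l => Z2 _ _)
    (fun l => F3 5 l (1, 3, l) rfl) (fun l => F3 6 l (1, 4, l) rfl) (fun l => F3 7 l (2, 4, l) rfl)
    (fun l => F3 1 l (1, 2, l) rfl) (fun l => F3 2 l (3, 4, l) rfl)
    (fun l hl => by
      have : l = 5 ∨ l = 6 ∨ l = 7 := by revert l; decide
      rcases this with rfl | rfl | rfl
      · exact ⟨F3 3 0 _ rfl, F3 3 3 _ rfl, F3 3 6 _ rfl, F3 4 0 _ rfl, F3 4 3 _ rfl⟩
      · exact ⟨F3 3 1 _ rfl, F3 3 4 _ rfl, F3 3 7 _ rfl, F3 4 1 _ rfl, F3 4 4 _ rfl⟩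
      · exact ⟨F3 3 2 _ rfl, F3 3 5 _ rfl, F3 4 6 _ rfl, F3 4 2 _ rfl, F3 4 5 _ rfl⟩)
  funext ⟨i, j, l⟩
  rcases i with i | i
  · rcases j with j | j
    · rcases l with l | l
      · exact key i j l
      · exact Z1 _ _ _
    · rw [hs]; exact Z3 _ _ _
  · exact Z3 _ _ _

end

open MvPolynomial in
/-- A point of the moduli space gives a homomorphism out of `Rring`. -/
lemma exists_point (k : Type) [Field k] (n : ℕ) (c : Fin n → Fin n → Fin n → k) (d : Fin n → k)
    (hc : ∀ i j l, c i j l = c j i l)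
    (ha : ∀ i j q l, ∑ s, c i j s * c s q l = ∑ s, c j q s * c i s l)
    (hd : ∀ j l, ∑ i, d i * c i j l = if j = l then 1 else 0) :
    ∃ ψ : Rring k n →ₐ[k] k, ∀ i j l, ψ (Ideal.Quotient.mk _ (X (Sum.inl (i, j, l)))) = c i j l := by
  let f : MvPolynomial ((Fin n × Fin n × Fin n) ⊕ Fin n) k →ₐ[k] k :=
    aeval (Sum.elim (fun t => c t.1 t.2.1 t.2.2) d)
  have hf : ∀ a ∈ Ideal.span (structRels k n), f a = 0 := by
    intro a h
    have : Ideal.span (structRels k n) ≤ RingHom.ker f := by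
      rw [Ideal.span_le]
      rintro _ ((⟨t, rfl⟩ | ⟨t, rfl⟩) | ⟨t, rfl⟩)
      · simp [f, RingHom.mem_ker, hc t.1 t.2.1]
      · simp [f, RingHom.mem_ker, ha t.1 t.2.1]
      · simp [f, RingHom.mem_ker, hd, apply_ite]
        intro h; simp [h]
    exact this h
  refine ⟨Ideal.Quotient.liftₐ _ f hf, fun i j l => ?_⟩
  rw [Ideal.Quotient.liftₐ_apply]
  simp [f]

lemma rel_zero (k : Type) [Field k] (n : ℕ) {a} (h : a ∈ structRels k n) :
    (Ideal.Quotient.mk (Ideal.span (structRels k n)) a) = 0 :=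
  Ideal.Quotient.eq_zero_iff_mem.2 (Ideal.subset_span h)

/-- For every field `k` and every `n ≥ 8`, the prime spectrum of `R_n(k)` is not
an irreducible topological space: the variety `B_{n,k}` is reducible. -/
theorem stmt9 (k : Type) [Field k] (n : ℕ) (hn : 8 ≤ n) :
    ¬ IrreducibleSpace (PrimeSpectrum (Rring k n)) := by
  rw [PrimeSpectrum.irreducibleSpace_iff_isPrime_nilradical]
  intro hprime
  obtain ⟨m, rfl⟩ := Nat.exists_eq_add_of_le hn
  let e : Fin 8 ⊕ Fin m ≃ Fin (8 + m) := finSumFinEquiv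
  let Q := Rring k (8 + m) ⧸ nilradical (Rring k (8 + m))
  have : IsDomain Q := Ideal.Quotient.isDomain _
  let π : Rring k (8 + m) →ₐ[k] Q := Ideal.Quotient.mkₐ k _
  let x : Fin (8 + m) → Fin (8 + m) → Fin (8 + m) → Rring k (8 + m) := fun i j l =>
    Ideal.Quotient.mk _ (MvPolynomial.X (Sum.inl (i, j, l)))
  have hxc : ∀ i j l, x i j l = x j i l := fun i j l => by
    have := rel_zero k (8 + m) (Or.inl (Or.inl ⟨(i, j, l), rfl⟩))
    rw [map_sub, sub_eq_zero] at this
    exact this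
  have hxa : ∀ i j q l, ∑ s, x i j s * x s q l = ∑ s, x j q s * x i s l := fun i j q l => by
    have := rel_zero k (8 + m) (Or.inl (Or.inr ⟨(i, j, q, l), rfl⟩))
    rw [map_sub, sub_eq_zero, map_sum, map_sum] at this
    simpa only [map_mul] using this
  have lift : ∀ ψ : Rring k (8 + m) →ₐ[k] k, ∃ ψ' : Q →ₐ[k] k, ∀ r, ψ' (π r) = ψ r := by
    intro ψ
    refine ⟨Ideal.Quotient.liftₐ _ ψ fun a ha => ?_, fun r => ?_⟩
    · exact ((mem_nilradical.1 ha).map ψ).eq_zero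
    · rfl
  let c : Fin 8 ⊕ Fin m → Fin 8 ⊕ Fin m → Fin 8 ⊕ Fin m → Q := fun i j l => π (x (e i) (e j) (e l))
  obtain ⟨ψ0, h0⟩ := exists_point k (8 + m)
    (fun i j l => c0 k m (e.symm i) (e.symm j) (e.symm l)) (fun i => d0 k m (e.symm i))
    (fun i j l => c0_comm _ _ _ _ _)
    (fun i j q l => by
      rw [e.symm.sum_comp (fun s => c0 k m (e.symm i) (e.symm j) s * c0 k m s (e.symm q) (e.symm l)),
        e.symm.sum_comp (fun s => c0 k m (e.symm j) (e.symm q) s * c0 k m (e.symm i) s (e.symm l))]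
      exact c0_assoc _ _ _ _ _ _)
    (fun j l => by
      rw [e.symm.sum_comp (fun i => d0 k m i * c0 k m i (e.symm j) (e.symm l)), c0_unit]
      simp)
  obtain ⟨ψ1, h1⟩ := exists_point k (8 + m)
    (fun i j l => if i = j ∧ j = l then 1 else 0) (fun _ => 1)
    (fun i j l => by grind)
    (fun i j q l => by simp [ite_and]; grind)
    (fun j l => by simp [ite_and])
  obtain ⟨ψ0', h0'⟩ := lift ψ0
  obtain ⟨ψ1', h1'⟩ := lift ψ1
  refine core ψ0' ψ1' c (fun i j l => by simp only [c, hxc (e i)]) (fun i j q l => ?_)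
    (fn0 m) (.inl 4, .inl 7) rfl ?_ ?_
  · simp only [c, ← map_mul, ← map_sum]
    rw [e.sum_comp (fun s => x (e i) (e j) s * x s (e q) (e l)),
      e.sum_comp (fun s => x (e j) (e q) s * x (e i) s (e l)), hxa]
  · have : (fun i j l => ψ0' (c i j l)) = c0 k m := by
      funext i j l
      simp only [c, h0', x, h0, Equiv.symm_apply_apply]
    rw [this]
    exact sys_inj k m
  · have : (fun i j l => ψ1' (c i j l)) = fun i j l => if i = j ∧ j = l then (1 : k) else 0 := by
      funext i j l
      simp only [c, h1', x, h1, EmbeddingLike.apply_eq_iff_eq]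
    rw [this]
    exact dlt_inj_diag
end
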